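/- Let d = 2 and g(x) = -log|x| on ℝ². Let β > 0 and let V : ℝ² → ℝ be continuous, such that the equilibrium measure μ_V exists and has an L^∞ density, such that ∫ exp(-βN(V(x)/2 - log|x|)) dx < ∞ for N large enough, and assume the next-order expansion |log Z_{N,β'} + (β'/2)N² I_V(μ_V) - (β'/4) N log N| ≤ C_{β'} N holds for β' ∈ {β, β/2}. Then there is a constant C depending on β and V such that for N large enough, |log E_{P_{N,β}}[ exp( (β/4)( F_N^{μ_V}(x₁,...,x_N) + (N/2) log N ) ) ]| ≤ C N, where P_{N,β} is the Gibbs measure with density Z_{N,β}^{-1} exp(-(β/2) H_N). -/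

import Mathlib

open MeasureTheory Filter Topology
open scoped ENNReal

noncomputable section

/-- The plane `ℝ²`. -/
abbrev Plane := EuclideanSpace ℝ (Fin 2)

/-- The real-valued two-dimensional logarithmic kernel `g(x) = -log|x|`. -/
def gR2 (x : Plane) : ℝ := - Real.log ‖x‖

open scoped Classical in
/-- The extended-real-valued logarithmic kernel, equal to `+∞` at the origin. -/
def gE2 (x : Plane) : EReal := if x = 0 then ⊤ else ((gR2 x : ℝ) : EReal)

/-- The integral of an extended-real-valued function (difference of the integrals of the
positive and negative parts). -/
def eIntE {α : Type*} [MeasurableSpace α] (μ : Measure α) (f : α → EReal) : EReal :=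
  ((∫⁻ x, (if f x = ⊤ then ⊤ else ENNReal.ofReal (f x).toReal) ∂μ : ℝ≥0∞) : EReal)
    - ((∫⁻ x, (if f x = ⊥ then ⊤ else ENNReal.ofReal (-(f x)).toReal) ∂μ : ℝ≥0∞) : EReal)

/-- The energy functional `I_V(μ) = ∬ g(x-y) dμ(x)dμ(y) + ∫ V dμ`, written as
`∬ [g(x-y) + V(x)/2 + V(y)/2] dμ(x)dμ(y)` with extended-real values; used to
characterize the equilibrium measure. -/
def IVE2 (V : Plane → ℝ) (μ : Measure Plane) : EReal :=
  eIntE (μ.prod μ) (fun p => gE2 (p.1 - p.2) + ((V p.1 / 2 + V p.2 / 2 : ℝ) : EReal))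

/-- The (real) value `I_V(μ) = ∬ g(x-y) dμ(x)dμ(y) + ∫ V dμ` (Bochner integrals). -/
def IVr2 (V : Plane → ℝ) (μ : Measure Plane) : ℝ :=
  (∫ p : Plane × Plane, gR2 (p.1 - p.2) ∂(μ.prod μ)) + ∫ x, V x ∂μ

/-- The `N`-point Hamiltonian `H_N = Σ_{i≠j} g(x_i-x_j) + N Σ_i V(x_i)`. -/
def HN2 (N : ℕ) (V : Plane → ℝ) (X : Fin N → Plane) : ℝ :=
  (∑ i, ∑ j, if i ≠ j then gR2 (X i - X j) else 0) + N * ∑ i, V (X i)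

/-- The partition function `Z_{N,β} = ∫ exp(-(β/2) H_N) dX_N`. -/
def ZN2 (N : ℕ) (β : ℝ) (V : Plane → ℝ) : ℝ≥0∞ :=
  ∫⁻ X : Fin N → Plane, ENNReal.ofReal (Real.exp (-(β / 2) * HN2 N V X))


/-- The canonical Gibbs measure `dP_{N,β} = Z_{N,β}⁻¹ exp(-(β/2) H_N) dX_N`. -/
def gibbs2 (N : ℕ) (β : ℝ) (V : Plane → ℝ) : Measure (Fin N → Plane) :=
  (ZN2 N β V)⁻¹ •
    volume.withDensity (fun X => ENNReal.ofReal (Real.exp (-(β / 2) * HN2 N V X)))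

/-- The electrostatic potential `h^μ(x) = ∫ g(x-y) dμ(y)` (Bochner integral). -/
def hpot2 (μ : Measure Plane) (x : Plane) : ℝ :=
  ∫ y, gR2 (x - y) ∂μ

/-- The next-order energy
`F_N^μ(X_N) = ∬_{Δᶜ} g(x-y) d(Σᵢ δ_{x_i} - Nμ)(x) d(Σᵢ δ_{x_i} - Nμ)(y)`, i.e.
`Σ_{i≠j} g(x_i-x_j) - 2N Σᵢ h^μ(x_i) + N² ∬ g dμdμ`, valued in the extended reals
(`+∞` when two points coincide). -/
def FN2 (N : ℕ) (μ : Measure Plane) (X : Fin N → Plane) : EReal :=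
  (∑ i, ∑ j, if i ≠ j then gE2 (X i - X j) else 0)
    + ((- 2 * N * ∑ i, hpot2 μ (X i)
        + (N : ℝ) ^ 2 * ∫ p : Plane × Plane, gR2 (p.1 - p.2) ∂(μ.prod μ) : ℝ) : EReal)

open scoped Classical in
/-- The exponential `EReal → [0,∞]`. -/
def expE (x : EReal) : ℝ≥0∞ :=
  if x = ⊤ then ⊤ else if x = ⊥ then 0 else ENNReal.ofReal (Real.exp x.toReal)

/-- The exponential moment `E_{P_{N,β}}[exp((β/4)(F_N^{μ_V} + (N/2) log N))]`. -/
def expMoment (N : ℕ) (β : ℝ) (V : Plane → ℝ) (μV : Measure Plane) : ℝ≥0∞ :=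
  ∫⁻ X : Fin N → Plane,
    expE (((β / 4 : ℝ) : EReal) *
      (FN2 N μV X + (((N : ℝ) / 2 * Real.log N : ℝ) : EReal))) ∂(gibbs2 N β V)

/-- The two-sided next-order expansion `|log Z_{N,β'} + (β'/2)N² I_V(μ_V) - (β'/4) N log N| ≤ C N`. -/
def ZexpansionBound (β' : ℝ) (V : Plane → ℝ) (μV : Measure Plane) (C : ℝ) : Prop :=
  ∀ᶠ N : ℕ in atTop,
    ENNReal.log (ZN2 N β' V)
        + (((β' / 2) * (N : ℝ) ^ 2 * IVr2 V μV - (β' / 4) * N * Real.log N : ℝ) : EReal)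
      ≤ ((C * N : ℝ) : EReal) ∧
    ((-(C * N) : ℝ) : EReal)
      ≤ ENNReal.log (ZN2 N β' V)
        + (((β' / 2) * (N : ℝ) ^ 2 * IVr2 V μV - (β' / 4) * N * Real.log N : ℝ) : EReal)

/-- A translation-invariant kernel `ψ(x - y)` is conditionally negative definite. -/
def CondNegDef (ψ : Plane → ℝ≥0∞) : Prop :=
  ∀ (P Q : Measure Plane) [IsFiniteMeasure P] [IsFiniteMeasure Q], P Set.univ = Q Set.univ →
    ∫⁻ p, ψ (p.1 - p.2) ∂(P.prod P) + ∫⁻ p, ψ (p.1 - p.2) ∂(Q.prod Q)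
      ≤ 2 * ∫⁻ p, ψ (p.1 - p.2) ∂(P.prod Q)

lemma CondNegDef.add {ψ φ : Plane → ℝ≥0∞} (hm : Measurable ψ) (hψ : CondNegDef ψ)
    (hφ : CondNegDef φ) : CondNegDef (fun z => ψ z + φ z) := by
  intro P Q _ _ hPQ
  have h : ∀ A B : Measure Plane, ∫⁻ p, (ψ (p.1 - p.2) + φ (p.1 - p.2)) ∂(A.prod B)
      = ∫⁻ p, ψ (p.1 - p.2) ∂(A.prod B) + ∫⁻ p, φ (p.1 - p.2) ∂(A.prod B) := fun A B =>
    lintegral_add_left (hm.comp (measurable_fst.sub measurable_snd)) _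
  rw [h, h, h, mul_add]
  calc _ = _ := add_add_add_comm _ _ _ _
    _ ≤ _ := add_le_add (hψ P Q hPQ) (hφ P Q hPQ)

lemma CondNegDef.lintegral {S : Type*} [MeasurableSpace S] {m : Measure S} [SFinite m]
    {w : S → ℝ≥0∞} {ψ : S → Plane → ℝ≥0∞} (hw : Measurable w)
    (hm : Measurable (Function.uncurry ψ))
    (hψ : ∀ᵐ s ∂m, CondNegDef (ψ s)) : CondNegDef (fun z => ∫⁻ s, w s * ψ s z ∂m) := by
  intro P Q _ _ hPQ
  have hm' : Measurable (fun q : (Plane × Plane) × S => ψ q.2 (q.1.1 - q.1.2)) :=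
    hm.comp (measurable_snd.prodMk
      ((measurable_fst.comp measurable_fst).sub (measurable_snd.comp measurable_fst)))
  have hms : ∀ s, Measurable (fun p : Plane × Plane => ψ s (p.1 - p.2)) := fun s =>
    hm'.comp (measurable_id.prodMk measurable_const)
  have h : ∀ (A B : Measure Plane) [IsFiniteMeasure A] [IsFiniteMeasure B],
      ∫⁻ p, ∫⁻ s, w s * ψ s (p.1 - p.2) ∂m ∂(A.prod B)
        = ∫⁻ s, w s * ∫⁻ p, ψ s (p.1 - p.2) ∂(A.prod B) ∂m := by
    intro A B _ _
    rw [lintegral_lintegral_swap]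
    · exact lintegral_congr fun s => lintegral_const_mul _ (hms s)
    · exact ((hw.comp measurable_snd).mul hm').aemeasurable
  have hmi : ∀ (A B : Measure Plane) [IsFiniteMeasure A] [IsFiniteMeasure B],
      Measurable fun s => w s * ∫⁻ p, ψ s (p.1 - p.2) ∂(A.prod B) := by
    intro A B _ _
    exact hw.mul (Measurable.lintegral_prod_left' (f := fun q : (Plane × Plane) × S =>
      ψ q.2 (q.1.1 - q.1.2)) hm')
  rw [h, h, h, ← lintegral_add_left (hmi P P), ← lintegral_const_mul _ (hmi P Q)]
  refine lintegral_mono_ae ?_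
  filter_upwards [hψ] with s hs
  rw [← mul_add, mul_left_comm]
  gcongr
  exact hs P Q hPQ

lemma CondNegDef.const_mul {ψ : Plane → ℝ≥0∞} (hm : Measurable ψ) (hψ : CondNegDef ψ)
    (c : ℝ≥0∞) : CondNegDef (fun z => c * ψ z) := by
  have := CondNegDef.lintegral (m := Measure.dirac ()) (w := fun _ => c) (ψ := fun _ => ψ)
    measurable_const (hm.comp measurable_snd) (ae_of_all _ fun _ => hψ)
  simpa using this

lemma ennreal_two_mul_le_add_sq (a b : ℝ≥0∞) : 2 * (a * b) ≤ a * a + b * b := by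
  wlog h : a ≤ b generalizing a b
  · rw [mul_comm a b, add_comm]
    exact this b a (le_of_not_ge h)
  obtain ⟨c, rfl⟩ := exists_add_of_le h
  have : a * a + (a + c) * (a + c) = 2 * (a * (a + c)) + c * c := by ring
  rw [this]
  exact le_self_add

/-- Positive definiteness of the kernel `∫ G(x - z) G(y - z) dz`. -/
lemma two_mul_lintegral_convolution_le {G : Plane → ℝ≥0∞} (hG : Measurable G)
    (P Q : Measure Plane) [IsFiniteMeasure P] [IsFiniteMeasure Q] :
    2 * ∫⁻ p, (∫⁻ z, G (p.1 - z) * G (p.2 - z)) ∂(P.prod Q)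
      ≤ ∫⁻ p, (∫⁻ z, G (p.1 - z) * G (p.2 - z)) ∂(P.prod P)
        + ∫⁻ p, (∫⁻ z, G (p.1 - z) * G (p.2 - z)) ∂(Q.prod Q) := by
  have hG' : ∀ z, Measurable fun x => G (x - z) := fun z => hG.comp (measurable_id.sub_const z)
  have h : ∀ (A B : Measure Plane) [IsFiniteMeasure A] [IsFiniteMeasure B],
      ∫⁻ p, (∫⁻ z, G (p.1 - z) * G (p.2 - z)) ∂(A.prod B)
        = ∫⁻ z, (∫⁻ x, G (x - z) ∂A) * ∫⁻ y, G (y - z) ∂B := by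
    intro A B _ _
    rw [lintegral_lintegral_swap]
    · exact lintegral_congr fun z => lintegral_prod_mul (hG' z).aemeasurable (hG' z).aemeasurable
    · exact ((hG.comp ((measurable_fst.comp measurable_fst).sub measurable_snd)).mul
        (hG.comp ((measurable_snd.comp measurable_fst).sub measurable_snd))).aemeasurable
  have hmi : ∀ (A : Measure Plane) [IsFiniteMeasure A], Measurable fun z => ∫⁻ x, G (x - z) ∂A := by
    intro A _
    exact Measurable.lintegral_prod_left' (f := fun q : Plane × Plane => G (q.1 - q.2))
      (hG.comp (measurable_fst.sub measurable_snd))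
  have hmul : ∀ (A B : Measure Plane) [IsFiniteMeasure A] [IsFiniteMeasure B],
      Measurable fun z => (∫⁻ x, G (x - z) ∂A) * ∫⁻ y, G (y - z) ∂B := fun A B _ _ =>
    (hmi A).mul (hmi B)
  rw [h, h, h, ← lintegral_add_left (hmul P P), ← lintegral_const_mul _ (hmul P Q)]
  exact lintegral_mono fun z => ennreal_two_mul_le_add_sq _ _

lemma lintegral_gaussian_mul_gaussian {t : ℝ} (x y : Plane) :
    ∫⁻ z, ENNReal.ofReal (Real.exp (-(2 * t) * ‖x - z‖ ^ 2))
        * ENNReal.ofReal (Real.exp (-(2 * t) * ‖y - z‖ ^ 2))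
      = (∫⁻ z : Plane, ENNReal.ofReal (Real.exp (-(4 * t) * ‖z‖ ^ 2)))
        * ENNReal.ofReal (Real.exp (-t * ‖x - y‖ ^ 2)) := by
  rw [← lintegral_sub_left_eq_self (fun z : Plane => ENNReal.ofReal (Real.exp (-(4 * t) * ‖z‖ ^ 2)))
    ((1 / 2 : ℝ) • (x + y)), ← lintegral_mul_const' _ _ ENNReal.ofReal_ne_top]
  refine lintegral_congr fun z => ?_
  rw [← ENNReal.ofReal_mul (Real.exp_pos _).le, ← ENNReal.ofReal_mul (Real.exp_pos _).le,
    ← Real.exp_add, ← Real.exp_add]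
  congr 2
  have h1 := parallelogram_law_with_norm ℝ (x - z) (y - z)
  have h2 : x - z + (y - z) = (2 : ℝ) • ((1 / 2 : ℝ) • (x + y) - z) := by module
  have h3 : x - z - (y - z) = x - y := by abel
  rw [h2, h3, norm_smul, Real.norm_ofNat] at h1
  linear_combination t * h1

lemma two_mul_lintegral_gaussian_le {t : ℝ} (ht : 0 < t) (P Q : Measure Plane)
    [IsFiniteMeasure P] [IsFiniteMeasure Q] :
    2 * ∫⁻ p, ENNReal.ofReal (Real.exp (-t * ‖p.1 - p.2‖ ^ 2)) ∂(P.prod Q)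
      ≤ ∫⁻ p, ENNReal.ofReal (Real.exp (-t * ‖p.1 - p.2‖ ^ 2)) ∂(P.prod P)
        + ∫⁻ p, ENNReal.ofReal (Real.exp (-t * ‖p.1 - p.2‖ ^ 2)) ∂(Q.prod Q) := by
  have hint := GaussianFourier.integral_rexp_neg_mul_sq_norm (V := Plane)
    (show 0 < 4 * t by positivity)
  have hpos : 0 < (Real.pi / (4 * t)) ^ ((Module.finrank ℝ Plane : ℝ) / 2) := by positivity
  have hI : Integrable fun v : Plane => Real.exp (-(4 * t) * ‖v‖ ^ 2) := by
    by_contra hc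
    rw [integral_undef hc] at hint
    exact hpos.ne hint
  have hc := ofReal_integral_eq_lintegral_ofReal hI (ae_of_all _ fun v => (Real.exp_pos _).le)
  rw [hint] at hc
  have h := two_mul_lintegral_convolution_le
    (G := fun z => ENNReal.ofReal (Real.exp (-(2 * t) * ‖z‖ ^ 2))) (by fun_prop) P Q
  simp only [lintegral_gaussian_mul_gaussian, ← hc] at h
  rw [lintegral_const_mul' _ _ ENNReal.ofReal_ne_top, lintegral_const_mul' _ _ ENNReal.ofReal_ne_top,
    lintegral_const_mul' _ _ ENNReal.ofReal_ne_top, ← mul_add, mul_left_comm] at h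
  exact (ENNReal.mul_le_mul_iff_right (by simpa using hpos) ENNReal.ofReal_ne_top).1 h

lemma condNegDef_one_sub_gaussian {t : ℝ} (ht : 0 < t) :
    CondNegDef fun z => ENNReal.ofReal (1 - Real.exp (-t * ‖z‖ ^ 2)) := by
  intro P Q _ _ hPQ
  have h : ∀ (A B : Measure Plane) [IsFiniteMeasure A] [IsFiniteMeasure B],
      ∫⁻ p, ENNReal.ofReal (1 - Real.exp (-t * ‖p.1 - p.2‖ ^ 2)) ∂(A.prod B)
        + ∫⁻ p, ENNReal.ofReal (Real.exp (-t * ‖p.1 - p.2‖ ^ 2)) ∂(A.prod B)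
        = A Set.univ * B Set.univ := by
    intro A B _ _
    rw [← lintegral_add_left (by fun_prop), ← Measure.prod_prod, Set.univ_prod_univ,
      ← lintegral_one]
    refine lintegral_congr fun p => ?_
    rw [← ENNReal.ofReal_add _ (Real.exp_pos _).le]
    · simp
    · rw [sub_nonneg, Real.exp_le_one_iff]
      nlinarith [sq_nonneg ‖p.1 - p.2‖]
  have hfin : ∀ (A B : Measure Plane) [IsFiniteMeasure A] [IsFiniteMeasure B],
      ∫⁻ p, ENNReal.ofReal (Real.exp (-t * ‖p.1 - p.2‖ ^ 2)) ∂(A.prod B) ≠ ⊤ := by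
    intro A B _ _
    refine ne_top_of_le_ne_top ?_ (le_add_self.trans (h A B).le)
    exact ENNReal.mul_ne_top (measure_ne_top _ _) (measure_ne_top _ _)
  have key := two_mul_lintegral_gaussian_le ht P Q
  refine (ENNReal.add_le_add_iff_right (ENNReal.add_ne_top.2 ⟨hfin P P, hfin Q Q⟩)).1 ?_
  calc _ = _ := add_add_add_comm _ _ _ _
    _ = 2 * (P Set.univ * Q Set.univ) := by rw [h, h, hPQ, two_mul]
    _ = _ := by rw [← h P Q, mul_add]
    _ ≤ _ := add_le_add le_rfl key

lemma lintegral_exp_mul_one_sub_gaussian {e : ℝ} (he : 0 < e) (z : Plane) :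
    ∫⁻ t in Set.Ioi (0 : ℝ), ENNReal.ofReal (Real.exp (-e * t))
        * ENNReal.ofReal (1 - Real.exp (-t * ‖z‖ ^ 2))
      = ENNReal.ofReal (1 / e - 1 / (‖z‖ ^ 2 + e)) := by
  have hz : 0 < ‖z‖ ^ 2 + e := by positivity
  have h1 := exp_neg_integrableOn_Ioi 0 he
  have h2 := exp_neg_integrableOn_Ioi 0 hz
  have h3 := integral_exp_mul_Ioi (neg_neg_of_pos he) 0
  have h4 := integral_exp_mul_Ioi (neg_neg_of_pos hz) 0
  have h5 : 1 / e - 1 / (‖z‖ ^ 2 + e) = ∫ t in Set.Ioi (0 : ℝ),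
      (Real.exp (-e * t) - Real.exp (-(‖z‖ ^ 2 + e) * t)) := by
    rw [integral_sub h1 h2, h3, h4]
    simp only [mul_zero, Real.exp_zero, neg_div_neg_eq]
  have h6 : IntegrableOn (fun t => Real.exp (-e * t) - Real.exp (-(‖z‖ ^ 2 + e) * t))
      (Set.Ioi 0) := h1.sub h2
  rw [h5, ofReal_integral_eq_lintegral_ofReal h6]
  · refine lintegral_congr fun t => ?_
    rw [← ENNReal.ofReal_mul (Real.exp_pos _).le, mul_sub, mul_one, ← Real.exp_add]
    congr 4
    ring
  · filter_upwards [ae_restrict_mem measurableSet_Ioi] with t ht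
    simp only [Pi.zero_apply, sub_nonneg, Real.exp_le_exp]
    have : (0 : ℝ) < t := ht
    nlinarith [mul_nonneg this.le (sq_nonneg ‖z‖)]

lemma lintegral_one_div_sub_one_div {ε a : ℝ} (hε : 0 < ε) (ha : 0 ≤ a) :
    ∫⁻ e in Set.Ioi ε, ENNReal.ofReal (1 / e - 1 / (a + e))
      = ENNReal.ofReal (Real.log (1 + a / ε)) := by
  have hd : ∀ x ∈ Set.Ici ε, HasDerivAt (fun e => Real.log e - Real.log (a + e))
      (1 / x - 1 / (a + x)) x := by
    intro x hx
    have hx0 : 0 < x := lt_of_lt_of_le hε hx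
    refine HasDerivAt.sub ?_ ?_
    · simpa using Real.hasDerivAt_log hx0.ne'
    · simpa using ((hasDerivAt_id x).const_add a).log (by positivity)
  have hn : ∀ x ∈ Set.Ioi ε, 0 ≤ 1 / x - 1 / (a + x) := by
    intro x hx
    have hx0 : 0 < x := hε.trans hx
    rw [sub_nonneg]
    exact one_div_le_one_div_of_le hx0 (by linarith)
  have ht : Tendsto (fun e => Real.log e - Real.log (a + e)) atTop (𝓝 0) := by
    have h1 : Tendsto (fun e : ℝ => 1 + a * e⁻¹) atTop (𝓝 (1 + a * 0)) :=
      tendsto_const_nhds.add (tendsto_inv_atTop_zero.const_mul a)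
    have h2 := ((Real.continuousAt_log (by norm_num : (1 + a * 0 : ℝ) ≠ 0)).tendsto.comp h1).neg
    simp only [mul_zero, add_zero, Real.log_one, neg_zero] at h2
    refine h2.congr' ?_
    filter_upwards [eventually_gt_atTop 0] with e he
    have : 1 + a * e⁻¹ = (a + e) / e := by field_simp; ring
    rw [Function.comp_apply, this, Real.log_div (by positivity) he.ne']
    ring
  have hint := integral_Ioi_of_hasDerivAt_of_nonneg' hd hn ht
  have hi := integrableOn_Ioi_deriv_of_nonneg' hd hn ht
  rw [← ofReal_integral_eq_lintegral_ofReal hi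
    ((ae_restrict_mem measurableSet_Ioi).mono fun x hx => hn x hx), hint]
  congr 1
  have : 1 + a / ε = (a + ε) / ε := by field_simp; ring
  rw [this, Real.log_div (by positivity) hε.ne']
  ring

/-- The regularisation `log(1 + |z|²/ε) + |z|²/(|z|² + ε)` of `2 log|z|`, up to a constant. -/
def regKernel (ε : ℝ) (z : Plane) : ℝ :=
  Real.log (1 + ‖z‖ ^ 2 / ε) + ‖z‖ ^ 2 / (‖z‖ ^ 2 + ε)

lemma condNegDef_regKernel {ε : ℝ} (hε : 0 < ε) :
    CondNegDef fun z => ENNReal.ofReal (regKernel ε z) := by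
  have h1 : ∀ e : ℝ, 0 < e → CondNegDef fun z => ENNReal.ofReal (1 / e - 1 / (‖z‖ ^ 2 + e)) := by
    intro e he
    have := CondNegDef.lintegral (m := volume.restrict (Set.Ioi (0 : ℝ)))
      (w := fun t => ENNReal.ofReal (Real.exp (-e * t)))
      (ψ := fun t z => ENNReal.ofReal (1 - Real.exp (-t * ‖z‖ ^ 2)))
      (by fun_prop) (by unfold Function.uncurry; fun_prop)
      ((ae_restrict_mem measurableSet_Ioi).mono fun t ht => condNegDef_one_sub_gaussian ht)
    simpa only [lintegral_exp_mul_one_sub_gaussian he] using this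
  have h2 : CondNegDef fun z => ENNReal.ofReal (Real.log (1 + ‖z‖ ^ 2 / ε)) := by
    have := CondNegDef.lintegral (m := volume.restrict (Set.Ioi ε)) (w := fun _ => 1)
      (ψ := fun e z => ENNReal.ofReal (1 / e - 1 / (‖z‖ ^ 2 + e)))
      (by fun_prop) (by unfold Function.uncurry; fun_prop)
      ((ae_restrict_mem measurableSet_Ioi).mono fun e he => h1 e (hε.trans he))
    simpa only [one_mul, lintegral_one_div_sub_one_div hε (sq_nonneg _)] using this
  have h3 := h2.add (by fun_prop) ((h1 ε hε).const_mul (by fun_prop) (ENNReal.ofReal ε))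
  convert h3 using 2 with z
  have hz : 0 < ‖z‖ ^ 2 + ε := by positivity
  rw [← ENNReal.ofReal_mul hε.le, ← ENNReal.ofReal_add, regKernel]
  · congr 2
    field_simp
    ring
  · exact Real.log_nonneg (le_add_of_nonneg_right (by positivity))
  · refine mul_nonneg hε.le (sub_nonneg.2 (one_div_le_one_div_of_le hε ?_))
    nlinarith [sq_nonneg ‖z‖]

/-- The positive part of the logarithmic kernel. -/
def logPole (z : Plane) : ℝ := max (-Real.log ‖z‖) 0

lemma logPole_nonneg (z : Plane) : 0 ≤ logPole z := le_max_right _ _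

/-- The error `-log|z| + regKernel 1 z / 2 - 1 / 2` made by the regularised kernel. -/
def regRemainder (z : Plane) : ℝ := (Real.log (1 + 1 / ‖z‖ ^ 2) - 1 / (1 + ‖z‖ ^ 2)) / 2

/-- The kernel `log(1 + |x|) + log(1 + |y|) - log|x - y|`, a version of the logarithmic kernel
compactified at infinity. -/
def compKernel (x y : Plane) : ℝ :=
  Real.log (1 + ‖x‖) + Real.log (1 + ‖y‖) - Real.log ‖x - y‖

lemma log_one_add_norm_nonneg (x : Plane) : 0 ≤ Real.log (1 + ‖x‖) :=
  Real.log_nonneg (le_add_of_nonneg_right (norm_nonneg x))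

lemma compKernel_comm (x y : Plane) : compKernel x y = compKernel y x := by
  rw [compKernel, compKernel, norm_sub_rev, add_comm (Real.log (1 + ‖x‖))]

lemma gR2_eq_compKernel (x y : Plane) :
    gR2 (x - y) = compKernel x y - Real.log (1 + ‖x‖) - Real.log (1 + ‖y‖) := by
  rw [gR2, compKernel]; ring

lemma compKernel_nonneg (x y : Plane) : 0 ≤ compKernel x y := by
  rw [compKernel, sub_nonneg]
  rcases eq_or_ne (x - y) 0 with h | h
  · rw [h, norm_zero, Real.log_zero]
    exact add_nonneg (log_one_add_norm_nonneg x) (log_one_add_norm_nonneg y)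
  · rw [← Real.log_mul (by positivity) (by positivity)]
    refine Real.log_le_log (norm_pos_iff.2 h) ((norm_sub_le x y).trans ?_)
    nlinarith [mul_nonneg (norm_nonneg x) (norm_nonneg y)]

lemma log_one_add_norm_le (x y : Plane) :
    Real.log (1 + ‖y‖) ≤ Real.log (1 + ‖x‖) + Real.log (1 + ‖x - y‖) := by
  rw [← Real.log_mul (by positivity) (by positivity)]
  refine Real.log_le_log (by positivity) ?_
  have : ‖y‖ ≤ ‖x‖ + ‖x - y‖ := by
    simpa [norm_sub_rev] using norm_le_insert x y
  nlinarith [mul_nonneg (norm_nonneg x) (norm_nonneg (x - y))]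

lemma log_one_add_norm_sub_le (x y : Plane) :
    Real.log (1 + ‖x - y‖) ≤ Real.log (1 + ‖x‖) + Real.log (1 + ‖y‖) := by
  rw [← Real.log_mul (by positivity) (by positivity)]
  refine Real.log_le_log (by positivity) ?_
  nlinarith [norm_sub_le x y, mul_nonneg (norm_nonneg x) (norm_nonneg y)]

lemma log_one_add_norm_sub_log_norm_le (z : Plane) :
    Real.log (1 + ‖z‖) - Real.log ‖z‖ ≤ logPole z + Real.log 2 := by
  rcases le_total 1 ‖z‖ with h | h
  · have h1 : Real.log (1 + ‖z‖) ≤ Real.log (2 * ‖z‖) :=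
      Real.log_le_log (by positivity) (by linarith)
    rw [Real.log_mul two_ne_zero (by positivity)] at h1
    have : 0 ≤ logPole z := logPole_nonneg z
    linarith
  · have h1 : Real.log (1 + ‖z‖) ≤ Real.log 2 := Real.log_le_log (by positivity) (by linarith)
    have : -Real.log ‖z‖ ≤ logPole z := le_max_left _ _
    linarith

lemma compKernel_le (x y : Plane) :
    compKernel x y ≤ 2 * Real.log (1 + ‖x‖) + (logPole (x - y) + Real.log 2) := by
  have h1 := log_one_add_norm_le x y
  have h2 := log_one_add_norm_sub_log_norm_le (x - y)
  rw [compKernel]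
  linarith

lemma log_sub_log_two_le_compKernel {x y : Plane} (h : ‖y‖ ≤ ‖x‖) :
    Real.log (1 + ‖y‖) - Real.log 2 ≤ compKernel x y := by
  have : Real.log ‖x - y‖ ≤ Real.log 2 + Real.log (1 + ‖x‖) := by
    rw [← Real.log_mul two_ne_zero (by positivity)]
    rcases eq_or_ne (x - y) 0 with h0 | h0
    · rw [h0, norm_zero, Real.log_zero]
      exact Real.log_nonneg (by nlinarith [norm_nonneg x])
    · exact Real.log_le_log (norm_pos_iff.2 h0) (by linarith [norm_sub_le x y, norm_nonneg x])
  rw [compKernel]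
  linarith

lemma regKernel_nonneg {ε : ℝ} (hε : 0 < ε) (z : Plane) : 0 ≤ regKernel ε z :=
  add_nonneg (Real.log_nonneg (le_add_of_nonneg_right (by positivity))) (by positivity)

lemma regKernel_sub_le {ε : ℝ} (hε : 0 < ε) (x y : Plane) :
    regKernel ε (x - y) ≤ (Real.log (1 + 1 / ε) + 1)
      + (2 * Real.log (1 + ‖x‖) + 2 * Real.log (1 + ‖y‖)) := by
  have h1 : Real.log (1 + ‖x - y‖ ^ 2 / ε) ≤ Real.log ((1 + 1 / ε) * (1 + ‖x - y‖) ^ 2) := by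
    refine Real.log_le_log (by positivity) ?_
    have h2 : 0 < 1 / ε := by positivity
    have h3 : ‖x - y‖ ^ 2 / ε = 1 / ε * ‖x - y‖ ^ 2 := by ring
    rw [h3]
    nlinarith [norm_nonneg (x - y), mul_nonneg h2.le (norm_nonneg (x - y)),
      sq_nonneg ‖x - y‖]
  rw [Real.log_mul (by positivity) (by positivity), Real.log_pow] at h1
  have h4 := log_one_add_norm_sub_le x y
  have h5 : ‖x - y‖ ^ 2 / (‖x - y‖ ^ 2 + ε) ≤ 1 :=
    div_le_one_of_le₀ (by linarith) (by positivity)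
  rw [regKernel]
  push_cast at h1
  linarith

lemma gR2_eq_regKernel {ε : ℝ} (hε : 0 < ε) {z : Plane} (hz : z ≠ 0) :
    gR2 z = -(1 / 2) * regKernel ε z + (1 / 2 - Real.log ε / 2)
      + regRemainder ((√ε)⁻¹ • z) := by
  have hr : 0 < ‖z‖ := norm_pos_iff.2 hz
  have hn : ‖(√ε)⁻¹ • z‖ ^ 2 = ‖z‖ ^ 2 / ε := by
    rw [norm_smul, mul_pow, norm_inv, Real.norm_of_nonneg (Real.sqrt_nonneg ε), inv_pow,
      Real.sq_sqrt hε.le]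
    ring
  have h1 : 1 + ‖z‖ ^ 2 / ε = (‖z‖ ^ 2 + ε) / ε := by field_simp; ring
  have h2 : 1 + 1 / (‖z‖ ^ 2 / ε) = (‖z‖ ^ 2 + ε) / ‖z‖ ^ 2 := by field_simp
  have h3 : 1 / ((‖z‖ ^ 2 + ε) / ε) = 1 - ‖z‖ ^ 2 / (‖z‖ ^ 2 + ε) := by field_simp; ring
  rw [gR2, regKernel, regRemainder, hn, h2, h1, h3, Real.log_div (by positivity) hε.ne',
    Real.log_div (by positivity) (by positivity), Real.log_pow]
  push_cast
  ring

lemma regRemainder_nonneg {z : Plane} (hz : z ≠ 0) : 0 ≤ regRemainder z := by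
  have hr : 0 < ‖z‖ := norm_pos_iff.2 hz
  have h := Real.one_sub_inv_le_log_of_pos (show 0 < 1 + 1 / ‖z‖ ^ 2 by positivity)
  have h1 : 1 - (1 + 1 / ‖z‖ ^ 2)⁻¹ = 1 / (1 + ‖z‖ ^ 2) := by field_simp; ring
  rw [regRemainder]
  linarith

lemma measurable_gR2 : Measurable gR2 := by unfold gR2; fun_prop

lemma measurable_logPole : Measurable logPole := by unfold logPole; fun_prop

lemma measurable_regKernel (ε : ℝ) : Measurable (regKernel ε) := by unfold regKernel; fun_prop

lemma measurable_compKernel : Measurable fun p : Plane × Plane => compKernel p.1 p.2 := by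
  unfold compKernel; fun_prop

lemma integrable_radial_of_mul_le {f : ℝ → ℝ} (hf : Measurable f)
    (h : ∀ y : ℝ, 0 < y → |y * f y| ≤ 2 * (1 + y ^ 2)⁻¹) :
    Integrable fun z : Plane => f ‖z‖ := by
  rw [integrable_fun_norm_addHaar volume, finrank_euclideanSpace_fin]
  refine Integrable.mono' ((integrable_inv_one_add_sq.const_mul 2).restrict)
    (by fun_prop) ((ae_restrict_mem measurableSet_Ioi).mono fun y hy => ?_)
  simpa using h y hy

lemma one_le_two_mul_inv_one_add_sq {y : ℝ} (hy : 0 < y) (hy1 : y ≤ 1) :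
    1 ≤ 2 * (1 + y ^ 2)⁻¹ := by
  rw [← div_eq_mul_inv, le_div_iff₀ (by positivity)]
  nlinarith

lemma integrable_logPole : Integrable logPole := by
  refine integrable_radial_of_mul_le (f := fun r => max (-Real.log r) 0) (by fun_prop)
    fun y hy => ?_
  rw [abs_of_nonneg (mul_nonneg hy.le (le_max_right _ _))]
  rcases le_total 1 y with h | h
  · rw [max_eq_right (by simpa using Real.log_nonneg h), mul_zero]
    positivity
  · refine le_trans ?_ (one_le_two_mul_inv_one_add_sq hy h)
    have h1 := Real.one_sub_inv_le_log_of_pos hy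
    have h2 : max (-Real.log y) 0 ≤ y⁻¹ :=
      max_le (by linarith) (by positivity)
    calc y * max (-Real.log y) 0 ≤ y * y⁻¹ := by gcongr
      _ = 1 := mul_inv_cancel₀ hy.ne'

lemma integrable_regRemainder : Integrable regRemainder := by
  refine integrable_radial_of_mul_le
    (f := fun r => (Real.log (1 + 1 / r ^ 2) - 1 / (1 + r ^ 2)) / 2) (by fun_prop)
    fun y hy => ?_
  have h0 : 0 ≤ (Real.log (1 + 1 / y ^ 2) - 1 / (1 + y ^ 2)) / 2 := by
    have h := Real.one_sub_inv_le_log_of_pos (show 0 < 1 + 1 / y ^ 2 by positivity)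
    have h1 : 1 - (1 + 1 / y ^ 2)⁻¹ = 1 / (1 + y ^ 2) := by field_simp; ring
    linarith
  rw [abs_of_nonneg (mul_nonneg hy.le h0)]
  rcases le_total 1 y with h | h
  · have h1 := Real.log_le_sub_one_of_pos (show 0 < 1 + 1 / y ^ 2 by positivity)
    have h2 : 1 / y ^ 2 - 1 / (1 + y ^ 2) = (1 / y ^ 2) * (1 + y ^ 2)⁻¹ := by
      field_simp; ring
    have h3 : y * (1 / y ^ 2) ≤ 1 := by
      rw [mul_one_div, div_le_one (by positivity)]
      nlinarith
    have h4 : 0 < (1 + y ^ 2)⁻¹ := by positivity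
    calc y * ((Real.log (1 + 1 / y ^ 2) - 1 / (1 + y ^ 2)) / 2)
        ≤ y * ((1 / y ^ 2 - 1 / (1 + y ^ 2)) / 2) := by gcongr; linarith
      _ = (y * (1 / y ^ 2)) * ((1 + y ^ 2)⁻¹ / 2) := by rw [h2]; ring
      _ ≤ 1 * ((1 + y ^ 2)⁻¹ / 2) := by gcongr
      _ ≤ _ := by linarith
  · refine le_trans ?_ (one_le_two_mul_inv_one_add_sq hy h)
    have h1 : Real.log (1 + 1 / y ^ 2) ≤ Real.log ((1 + 1 / y) ^ 2) := by
      refine Real.log_le_log (by positivity) ?_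
      have : 0 < 1 / y := by positivity
      rw [← one_div_pow]
      nlinarith
    rw [Real.log_pow] at h1
    have h2 := Real.log_le_sub_one_of_pos (show 0 < 1 + 1 / y by positivity)
    have h3 : 0 < 1 / (1 + y ^ 2) := by positivity
    push_cast at h1
    calc y * ((Real.log (1 + 1 / y ^ 2) - 1 / (1 + y ^ 2)) / 2)
        ≤ y * (1 / y) := mul_le_mul_of_nonneg_left (by linarith) hy.le
      _ = 1 := mul_one_div_cancel hy.ne'

lemma integral_regRemainder_scaled {ε : ℝ} (hε : 0 < ε) (x : Plane) :
    ∫ y, regRemainder ((√ε)⁻¹ • (x - y)) = ε * ∫ z, regRemainder z := by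
  rw [integral_sub_left_eq_self (fun z => regRemainder ((√ε)⁻¹ • z)) volume x,
    Measure.integral_comp_smul, finrank_euclideanSpace_fin, inv_pow, inv_inv,
    Real.sq_sqrt hε.le, abs_of_pos hε, smul_eq_mul]

section BoundedDensity

variable {μ : Measure Plane} {M : ℝ≥0∞}

lemma Integrable.of_le_smul_volume (hM : M ≠ ⊤) (hμ : μ ≤ M • volume) {f : Plane → ℝ}
    (hf : Integrable f) : Integrable f μ :=
  (hf.smul_measure hM).mono_measure hμ

lemma integrable_logPole_sub (hM : M ≠ ⊤) (hμ : μ ≤ M • volume) (x : Plane) :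
    Integrable (fun y => logPole (x - y)) μ :=
  Integrable.of_le_smul_volume hM hμ (integrable_logPole.comp_sub_left x)

lemma integral_logPole_sub_le (hM : M ≠ ⊤) (hμ : μ ≤ M • volume) (x : Plane) :
    ∫ y, logPole (x - y) ∂μ ≤ M.toReal * ∫ z, logPole z := by
  have h := integral_mono_measure hμ (ae_of_all _ fun y => logPole_nonneg (x - y))
    ((integrable_logPole.comp_sub_left x).smul_measure hM)
  rwa [integral_smul_measure, integral_sub_left_eq_self logPole volume x] at h

lemma ae_ne_of_le_smul_volume (hμ : μ ≤ M • volume) (x : Plane) : ∀ᵐ y ∂μ, x ≠ y := by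
  have h : μ ≪ volume := (Measure.absolutelyContinuous_of_le hμ).trans
    Measure.smul_absolutelyContinuous
  have hx : ∀ᵐ y ∂(volume : Measure Plane), x ≠ y := by
    rw [ae_iff]
    simp
  exact h.ae_le hx

lemma ae_prod_ne (ν : Measure Plane) [SFinite ν] [SFinite μ] (hμ : μ ≤ M • volume) :
    ∀ᵐ p ∂(ν.prod μ), p.1 ≠ p.2 := by
  rw [Measure.ae_prod_iff_ae_ae]
  · exact ae_of_all _ fun x => ae_ne_of_le_smul_volume hμ x
  · exact (measurableSet_eq_fun measurable_fst measurable_snd).compl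

lemma integrable_prod_logPole (hM : M ≠ ⊤) (ν : Measure Plane) [IsFiniteMeasure ν]
    [IsFiniteMeasure μ] (hμ : μ ≤ M • volume) :
    Integrable (fun p : Plane × Plane => logPole (p.1 - p.2)) (ν.prod μ) := by
  have hm : Measurable fun p : Plane × Plane => logPole (p.1 - p.2) :=
    measurable_logPole.comp (measurable_fst.sub measurable_snd)
  rw [integrable_prod_iff hm.aestronglyMeasurable]
  refine ⟨ae_of_all _ fun x => integrable_logPole_sub hM hμ x, ?_⟩
  refine Integrable.of_bound (hm.norm.aestronglyMeasurable.integral_prod_right')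
    (M.toReal * ∫ z, logPole z) (ae_of_all _ fun x => ?_)
  have hn : ∀ z, ‖logPole z‖ = logPole z := fun z => Real.norm_of_nonneg (logPole_nonneg z)
  simp only [hn]
  rw [Real.norm_of_nonneg (integral_nonneg fun y => logPole_nonneg (x - y))]
  exact integral_logPole_sub_le hM hμ x

lemma integrable_compKernel [IsFiniteMeasure μ] (hM : M ≠ ⊤) (hμ : μ ≤ M • volume) (x : Plane) :
    Integrable (fun y => compKernel x y) μ := by
  refine Integrable.mono' ((integrable_const (2 * Real.log (1 + ‖x‖))).add
    ((integrable_logPole_sub hM hμ x).add (integrable_const (Real.log 2))))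
    (measurable_compKernel.comp measurable_prodMk_left).aestronglyMeasurable
    (ae_of_all _ fun y => ?_)
  rw [Real.norm_of_nonneg (compKernel_nonneg x y)]
  exact compKernel_le x y

lemma integrable_gR2_sub [IsFiniteMeasure μ] (hM : M ≠ ⊤) (hμ : μ ≤ M • volume)
    (hlog : Integrable (fun y : Plane => Real.log (1 + ‖y‖)) μ) (x : Plane) :
    Integrable (fun y => gR2 (x - y)) μ := by
  simp only [gR2_eq_compKernel]
  exact ((integrable_compKernel hM hμ x).sub (integrable_const _)).sub hlog

lemma integrable_prod_gR2 [IsFiniteMeasure μ] (hM : M ≠ ⊤) (hμ : μ ≤ M • volume)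
    (hlog : Integrable (fun y : Plane => Real.log (1 + ‖y‖)) μ) :
    Integrable (fun p : Plane × Plane => gR2 (p.1 - p.2)) (μ.prod μ) := by
  have hl1 : Integrable (fun p : Plane × Plane => Real.log (1 + ‖p.1‖)) (μ.prod μ) :=
    hlog.comp_fst μ
  have hl2 : Integrable (fun p : Plane × Plane => Real.log (1 + ‖p.2‖)) (μ.prod μ) :=
    hlog.comp_snd μ
  have hq : Integrable (fun p : Plane × Plane => compKernel p.1 p.2) (μ.prod μ) := by
    refine Integrable.mono' ((hl1.const_mul 2).add
      ((integrable_prod_logPole hM μ hμ).add (integrable_const (Real.log 2))))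
      measurable_compKernel.aestronglyMeasurable (ae_of_all _ fun p => ?_)
    rw [Real.norm_of_nonneg (compKernel_nonneg _ _)]
    exact compKernel_le _ _
  simp only [gR2_eq_compKernel]
  exact (hq.sub hl1).sub hl2

lemma integrable_regKernel_sub [IsFiniteMeasure μ]
    (hlog : Integrable (fun y : Plane => Real.log (1 + ‖y‖)) μ) {ε : ℝ} (hε : 0 < ε) (x : Plane) :
    Integrable (fun y => regKernel ε (x - y)) μ := by
  refine Integrable.mono' ((integrable_const (Real.log (1 + 1 / ε) + 1)).add
    ((integrable_const (2 * Real.log (1 + ‖x‖))).add (hlog.const_mul 2)))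
    ((measurable_regKernel ε).comp (measurable_const.sub measurable_id)).aestronglyMeasurable
    (ae_of_all _ fun y => ?_)
  rw [Real.norm_of_nonneg (regKernel_nonneg hε _)]
  exact regKernel_sub_le hε x y

lemma integrable_prod_regKernel [IsFiniteMeasure μ]
    (hlog : Integrable (fun y : Plane => Real.log (1 + ‖y‖)) μ) {ε : ℝ} (hε : 0 < ε) :
    Integrable (fun p : Plane × Plane => regKernel ε (p.1 - p.2)) (μ.prod μ) := by
  have hl1 : Integrable (fun p : Plane × Plane => Real.log (1 + ‖p.1‖)) (μ.prod μ) :=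
    hlog.comp_fst μ
  have hl2 : Integrable (fun p : Plane × Plane => Real.log (1 + ‖p.2‖)) (μ.prod μ) :=
    hlog.comp_snd μ
  refine Integrable.mono' ((integrable_const (Real.log (1 + 1 / ε) + 1)).add
    ((hl1.const_mul 2).add (hl2.const_mul 2)))
    ((measurable_regKernel ε).comp (measurable_fst.sub measurable_snd)).aestronglyMeasurable
    (ae_of_all _ fun p => ?_)
  rw [Real.norm_of_nonneg (regKernel_nonneg hε _)]
  exact regKernel_sub_le hε p.1 p.2

end BoundedDensity

section NextOrderEnergy

variable {μ : Measure Plane} {M : ℝ≥0∞}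

/-- Conditional negative definiteness of `regKernel`, tested against `Σ δ_{x_i} - N μ`. -/
lemma sum_regKernel_add_le [IsProbabilityMeasure μ]
    (hlog : Integrable (fun y : Plane => Real.log (1 + ‖y‖)) μ) {ε : ℝ} (hε : 0 < ε)
    {N : ℕ} (X : Fin N → Plane) :
    ∑ i, ∑ j, regKernel ε (X i - X j)
        + (N : ℝ) ^ 2 * ∫ p : Plane × Plane, regKernel ε (p.1 - p.2) ∂(μ.prod μ)
      ≤ 2 * N * ∑ i, ∫ y, regKernel ε (X i - y) ∂μ := by
  have hm : Measurable fun p : Plane × Plane => ENNReal.ofReal (regKernel ε (p.1 - p.2)) :=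
    ((measurable_regKernel ε).comp (measurable_fst.sub measurable_snd)).ennreal_ofReal
  have hN : IsFiniteMeasure ((N : ℝ≥0∞) • μ) := ⟨by simp⟩
  have hmass : (∑ i, Measure.dirac (X i)) Set.univ = ((N : ℝ≥0∞) • μ) Set.univ := by simp
  have h := condNegDef_regKernel hε (∑ i, Measure.dirac (X i)) ((N : ℝ≥0∞) • μ) hmass
  have h1 : ∫⁻ p, ENNReal.ofReal (regKernel ε (p.1 - p.2))
      ∂((∑ i, Measure.dirac (X i)).prod (∑ i, Measure.dirac (X i)))
      = ENNReal.ofReal (∑ i, ∑ j, regKernel ε (X i - X j)) := by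
    rw [lintegral_prod _ hm.aemeasurable, lintegral_finsetSum_measure,
      ENNReal.ofReal_sum_of_nonneg fun i _ =>
        Finset.sum_nonneg fun j _ => regKernel_nonneg hε _]
    refine Finset.sum_congr rfl fun i _ => ?_
    rw [lintegral_dirac, lintegral_finsetSum_measure,
      ENNReal.ofReal_sum_of_nonneg fun j _ => regKernel_nonneg hε _]
    exact Finset.sum_congr rfl fun j _ => lintegral_dirac _ _
  have h2 : ∫⁻ p, ENNReal.ofReal (regKernel ε (p.1 - p.2))
      ∂(((N : ℝ≥0∞) • μ).prod ((N : ℝ≥0∞) • μ))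
      = ENNReal.ofReal ((N : ℝ) ^ 2 * ∫ p : Plane × Plane, regKernel ε (p.1 - p.2) ∂(μ.prod μ)) := by
    rw [Measure.prod_smul_left, Measure.prod_smul_right, lintegral_smul_measure,
      lintegral_smul_measure, ENNReal.ofReal_mul (by positivity),
      ofReal_integral_eq_lintegral_ofReal (integrable_prod_regKernel hlog hε)
        (Eventually.of_forall fun _ => regKernel_nonneg hε _),
      ENNReal.ofReal_pow (by positivity), ENNReal.ofReal_natCast, smul_eq_mul, smul_eq_mul,
      sq, mul_assoc]
  have h3 : ∫⁻ p, ENNReal.ofReal (regKernel ε (p.1 - p.2))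
      ∂((∑ i, Measure.dirac (X i)).prod ((N : ℝ≥0∞) • μ))
      = ENNReal.ofReal (N * ∑ i, ∫ y, regKernel ε (X i - y) ∂μ) := by
    rw [Measure.prod_smul_right, lintegral_smul_measure, lintegral_prod _ hm.aemeasurable,
      lintegral_finsetSum_measure, ENNReal.ofReal_mul (by positivity), ENNReal.ofReal_natCast,
      smul_eq_mul, ENNReal.ofReal_sum_of_nonneg fun i _ =>
        integral_nonneg fun y => regKernel_nonneg hε _]
    congr 1
    refine Finset.sum_congr rfl fun i _ => ?_
    rw [lintegral_dirac, ofReal_integral_eq_lintegral_ofReal (integrable_regKernel_sub hlog hε _)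
        (Eventually.of_forall fun _ => regKernel_nonneg hε _)]
  have hs : 0 ≤ ∑ i, ∑ j, regKernel ε (X i - X j) :=
    Finset.sum_nonneg fun i _ => Finset.sum_nonneg fun j _ => regKernel_nonneg hε _
  have hI : 0 ≤ ∫ p : Plane × Plane, regKernel ε (p.1 - p.2) ∂(μ.prod μ) :=
    integral_nonneg fun _ => regKernel_nonneg hε _
  have hS : 0 ≤ ∑ i, ∫ y, regKernel ε (X i - y) ∂μ :=
    Finset.sum_nonneg fun i _ => integral_nonneg fun y => regKernel_nonneg hε _
  have htwo : ∀ s : ℝ, 2 * ENNReal.ofReal s = ENNReal.ofReal (2 * s) := fun s => by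
    rw [ENNReal.ofReal_mul (by norm_num), ENNReal.ofReal_ofNat]
  rw [h1, h2, h3, ← ENNReal.ofReal_add hs (by positivity),
    htwo, ENNReal.ofReal_le_ofReal_iff (by positivity)] at h
  linarith

lemma neg_regKernel_le_gR2 {ε : ℝ} (hε : 0 < ε) {z : Plane} (hz : z ≠ 0) :
    -(1 / 2) * regKernel ε z + (1 / 2 - Real.log ε / 2) ≤ gR2 z := by
  have hs : (√ε)⁻¹ ≠ 0 := (inv_pos.2 (Real.sqrt_pos.2 hε)).ne'
  rw [gR2_eq_regKernel hε hz]
  linarith [regRemainder_nonneg (smul_ne_zero hs hz)]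

lemma integrable_regRemainder_scaled (hM : M ≠ ⊤) (hμ : μ ≤ M • volume) {ε : ℝ} (hε : 0 < ε)
    (x : Plane) : Integrable (fun y => regRemainder ((√ε)⁻¹ • (x - y))) μ := by
  have hs : (√ε)⁻¹ ≠ 0 := (inv_pos.2 (Real.sqrt_pos.2 hε)).ne'
  exact Integrable.of_le_smul_volume hM hμ
    ((integrable_regRemainder.comp_smul hs).comp_sub_left x)

lemma hpot2_le [IsProbabilityMeasure μ] (hM : M ≠ ⊤) (hμ : μ ≤ M • volume)
    (hlog : Integrable (fun y : Plane => Real.log (1 + ‖y‖)) μ) {ε : ℝ} (hε : 0 < ε) (x : Plane) :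
    hpot2 μ x ≤ -(1 / 2) * ∫ y, regKernel ε (x - y) ∂μ + (1 / 2 - Real.log ε / 2)
      + M.toReal * (ε * ∫ z, regRemainder z) := by
  have hs : (√ε)⁻¹ ≠ 0 := (inv_pos.2 (Real.sqrt_pos.2 hε)).ne'
  have hne := ae_ne_of_le_smul_volume hμ x
  have hr := integrable_regRemainder_scaled hM hμ hε x
  have hk := integrable_regKernel_sub hlog hε x
  have h0 : ∀ᵐ y ∂(volume : Measure Plane), 0 ≤ regRemainder ((√ε)⁻¹ • (x - y)) := by
    have h : ∀ᵐ y ∂(volume : Measure Plane), x ≠ y :=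
      ae_ne_of_le_smul_volume (M := 1) (by simp) x
    filter_upwards [h] with y hy
    exact regRemainder_nonneg (smul_ne_zero hs (sub_ne_zero.2 hy))
  have hrle : ∫ y, regRemainder ((√ε)⁻¹ • (x - y)) ∂μ ≤ M.toReal * (ε * ∫ z, regRemainder z) := by
    rw [← integral_regRemainder_scaled hε x, ← smul_eq_mul, ← integral_smul_measure]
    refine integral_mono_measure hμ (Measure.ae_smul_measure h0 M) ?_
    exact ((integrable_regRemainder.comp_smul hs).comp_sub_left x).smul_measure hM
  have heq : hpot2 μ x = ∫ y, (-(1 / 2) * regKernel ε (x - y) + (1 / 2 - Real.log ε / 2)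
      + regRemainder ((√ε)⁻¹ • (x - y))) ∂μ :=
    integral_congr_ae (hne.mono fun y hy => gR2_eq_regKernel hε (sub_ne_zero.2 hy))
  have : hpot2 μ x = -(1 / 2) * ∫ y, regKernel ε (x - y) ∂μ + (1 / 2 - Real.log ε / 2)
      + ∫ y, regRemainder ((√ε)⁻¹ • (x - y)) ∂μ := by
    have hk' : Integrable (fun y => -(1 / 2) * regKernel ε (x - y) + (1 / 2 - Real.log ε / 2)) μ :=
      (hk.const_mul _).add (integrable_const _)
    rw [heq, integral_add hk' hr,
      integral_add (hk.const_mul _) (integrable_const _), integral_const_mul]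
    simp
  linarith

lemma le_integral_prod_gR2 [IsProbabilityMeasure μ] (hM : M ≠ ⊤) (hμ : μ ≤ M • volume)
    (hlog : Integrable (fun y : Plane => Real.log (1 + ‖y‖)) μ) {ε : ℝ} (hε : 0 < ε) :
    -(1 / 2) * ∫ p : Plane × Plane, regKernel ε (p.1 - p.2) ∂(μ.prod μ)
        + (1 / 2 - Real.log ε / 2)
      ≤ ∫ p : Plane × Plane, gR2 (p.1 - p.2) ∂(μ.prod μ) := by
  have hk := integrable_prod_regKernel hlog hε
  have h := integral_mono_ae ((hk.const_mul (-(1 / 2))).add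
    (integrable_const (1 / 2 - Real.log ε / 2))) (integrable_prod_gR2 hM hμ hlog)
    ((ae_prod_ne μ hμ).mono fun p hp => neg_regKernel_le_gR2 hε (sub_ne_zero.2 hp))
  simp only [Pi.add_apply] at h
  rw [integral_add (hk.const_mul _) (integrable_const _), integral_const_mul] at h
  simpa using h

/-- The real value of the next-order energy of a configuration without collisions. -/
def nextOrderEnergy (N : ℕ) (μ : Measure Plane) (X : Fin N → Plane) : ℝ :=
  (∑ i, ∑ j, if i ≠ j then gR2 (X i - X j) else 0)
    + (-2 * N * ∑ i, hpot2 μ (X i)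
      + (N : ℝ) ^ 2 * ∫ p : Plane × Plane, gR2 (p.1 - p.2) ∂(μ.prod μ))

/-- The next-order energy of a configuration without collisions is bounded below by
`-(N / 2) log N` up to an error of order `N`. -/
lemma le_nextOrderEnergy [IsProbabilityMeasure μ] (hM : M ≠ ⊤) (hμ : μ ≤ M • volume)
    (hlog : Integrable (fun y : Plane => Real.log (1 + ‖y‖)) μ) {N : ℕ} (hN : 0 < N)
    {X : Fin N → Plane} (hX : Function.Injective X) :
    -(1 / 2 + 2 * M.toReal * ∫ z, regRemainder z) * N
      ≤ nextOrderEnergy N μ X + N / 2 * Real.log N := by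
  have hN' : (0 : ℝ) < N := Nat.cast_pos.2 hN
  have hε : (0 : ℝ) < (N : ℝ)⁻¹ := inv_pos.2 hN'
  set ε : ℝ := (N : ℝ)⁻¹ with hεdef
  have hlε : Real.log ε = -Real.log N := Real.log_inv _
  set c : ℝ := 1 / 2 - Real.log ε / 2 with hc
  have hψ := sum_regKernel_add_le hlog hε X
  have hI := le_integral_prod_gR2 hM hμ hlog hε
  rw [← hc] at hI
  have hS : ∑ i, hpot2 μ (X i) ≤ -(1 / 2) * ∑ i, ∫ y, regKernel ε (X i - y) ∂μ
      + N * (c + M.toReal * (ε * ∫ z, regRemainder z)) := by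
    refine (Finset.sum_le_sum fun i _ => hpot2_le hM hμ hlog hε (X i)).trans_eq ?_
    rw [Finset.sum_add_distrib, Finset.sum_add_distrib, ← Finset.mul_sum]
    simp
    ring
  have hD : -(1 / 2) * ∑ i, ∑ j, regKernel ε (X i - X j) + ((N : ℝ) ^ 2 - N) * c
      ≤ ∑ i, ∑ j, if i ≠ j then gR2 (X i - X j) else 0 := by
    have h : ∑ i, ∑ j, (-(1 / 2) * regKernel ε (X i - X j) + if i ≠ j then c else 0)
        ≤ ∑ i, ∑ j, if i ≠ j then gR2 (X i - X j) else 0 := by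
      refine Finset.sum_le_sum fun i _ => Finset.sum_le_sum fun j _ => ?_
      by_cases hij : i = j
      · simp [hij, regKernel]
      · simp only [ne_eq, hij, not_false_eq_true, if_true]
        exact neg_regKernel_le_gR2 hε (sub_ne_zero.2 (hX.ne hij))
    refine le_trans (le_of_eq ?_) h
    have hcount : ∀ i : Fin N, ∑ j, (if i ≠ j then c else 0) = (N - 1) * c := by
      intro i
      have : ∀ j, (if i ≠ j then c else 0) = c - if i = j then c else 0 := by
        intro j; split_ifs <;> simp_all
      simp only [this, Finset.sum_sub_distrib, Finset.sum_ite_eq, Finset.mem_univ, if_true]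
      simp
      ring
    simp only [Finset.sum_add_distrib, hcount, ← Finset.mul_sum]
    simp
    ring
  have hNI := mul_le_mul_of_nonneg_left hI (sq_nonneg (N : ℝ))
  have hNS := mul_le_mul_of_nonneg_left hS (by positivity : (0 : ℝ) ≤ 2 * N)
  have hNε : (N : ℝ) * ε = 1 := mul_inv_cancel₀ hN'.ne'
  have hR : (N : ℝ) * (N * (M.toReal * (ε * ∫ z, regRemainder z)))
      = N * (M.toReal * ∫ z, regRemainder z) := by
    linear_combination (N * M.toReal * ∫ z, regRemainder z) * hNε
  have hcN : c * N = N / 2 + N / 2 * Real.log N := by rw [hc, hlε]; ring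
  unfold nextOrderEnergy
  nlinarith

end NextOrderEnergy

section MeanFieldEnergy

/-- The symmetrised two-point energy `g(x - y) + V(x) / 2 + V(y) / 2`. -/
def pairEnergy (V : Plane → ℝ) (p : Plane × Plane) : ℝ :=
  gR2 (p.1 - p.2) + (V p.1 / 2 + V p.2 / 2)

/-- The potential `V / 2 - log(1 + |x|)`, the external field complementary to `compKernel`. -/
def compWeight (V : Plane → ℝ) (x : Plane) : ℝ := V x / 2 - Real.log (1 + ‖x‖)

open scoped Classical in
/-- The negative part of the two-point energy, set to zero on the diagonal. -/
def negPair (V : Plane → ℝ) (p : Plane × Plane) : ℝ≥0∞ :=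
  if p.1 = p.2 then 0 else ENNReal.ofReal (-pairEnergy V p)

open scoped Classical in
/-- The positive part of the two-point energy, set to infinity on the diagonal. -/
def posPair (V : Plane → ℝ) (p : Plane × Plane) : ℝ≥0∞ :=
  if p.1 = p.2 then ⊤ else ENNReal.ofReal (pairEnergy V p)

variable {V : Plane → ℝ} {μ : Measure Plane} {M : ℝ≥0∞}

lemma pairEnergy_eq (V : Plane → ℝ) (x y : Plane) :
    pairEnergy V (x, y) = compWeight V x + compWeight V y + compKernel x y := by
  simp only [pairEnergy, compWeight, gR2_eq_compKernel]
  ring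

lemma pairEnergy_swap (V : Plane → ℝ) (p : Plane × Plane) :
    pairEnergy V p.swap = pairEnergy V p := by
  obtain ⟨x, y⟩ := p
  simp only [Prod.swap_prod_mk, pairEnergy_eq, compKernel_comm x y]
  ring

lemma continuous_compWeight (hV : Continuous V) : Continuous (compWeight V) := by
  have h : ∀ x : Plane, 1 + ‖x‖ ≠ 0 := fun x => by positivity
  unfold compWeight
  fun_prop (disch := exact h _)

lemma measurable_pairEnergy (hV : Measurable V) : Measurable (pairEnergy V) := by
  have h : Measurable fun p : Plane × Plane => gR2 (p.1 - p.2) :=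
    measurable_gR2.comp (measurable_fst.sub measurable_snd)
  unfold pairEnergy
  fun_prop

lemma measurableSet_fst_eq_snd : MeasurableSet {p : Plane × Plane | p.1 = p.2} :=
  (isClosed_eq continuous_fst continuous_snd).measurableSet

lemma measurable_negPair (hV : Measurable V) : Measurable (negPair V) :=
  Measurable.ite measurableSet_fst_eq_snd measurable_const
    (measurable_pairEnergy hV).neg.ennreal_ofReal

lemma IVE2_eq (V : Plane → ℝ) (μ : Measure Plane) :
    IVE2 V μ = ((∫⁻ p, posPair V p ∂(μ.prod μ) : ℝ≥0∞) : EReal)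
      - ((∫⁻ p, negPair V p ∂(μ.prod μ) : ℝ≥0∞) : EReal) := by
  have h : ∀ p : Plane × Plane, gE2 (p.1 - p.2) + ((V p.1 / 2 + V p.2 / 2 : ℝ) : EReal)
      = if p.1 = p.2 then ⊤ else ((pairEnergy V p : ℝ) : EReal) := by
    intro p
    by_cases hp : p.1 = p.2
    · simp [gE2, hp]
    · rw [gE2, if_neg (sub_ne_zero.2 hp), if_neg hp, ← EReal.coe_add]
      rfl
  unfold IVE2 eIntE
  simp only [h]
  congr 3
  · funext p
    by_cases hp : p.1 = p.2 <;> simp [posPair, hp]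
  · funext p
    by_cases hp : p.1 = p.2
    · simp [negPair, hp]
    · simp only [negPair, hp, if_false, EReal.coe_ne_bot, ← EReal.coe_neg, EReal.toReal_coe]

lemma IVE2_eq_bot_of_negPair (h : ∫⁻ p, negPair V p ∂(μ.prod μ) = ⊤) : IVE2 V μ = ⊥ := by
  rw [IVE2_eq, h, EReal.coe_ennreal_top, EReal.sub_top]

lemma IVE2_ne_bot_of_negPair (h : ∫⁻ p, negPair V p ∂(μ.prod μ) ≠ ⊤) : IVE2 V μ ≠ ⊥ := by
  lift ∫⁻ p, negPair V p ∂(μ.prod μ) to NNReal using h with b hb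
  rw [IVE2_eq, ← hb]
  cases ∫⁻ p, posPair V p ∂(μ.prod μ) with
  | top => simp
  | coe a =>
    rw [EReal.coe_nnreal_eq_coe_real, EReal.coe_nnreal_eq_coe_real, ← EReal.coe_sub]
    exact EReal.coe_ne_bot _

lemma posPair_ne_top_of_IVE2 (hn : ∫⁻ p, negPair V p ∂(μ.prod μ) ≠ ⊤) (h : IVE2 V μ ≠ ⊤) :
    ∫⁻ p, posPair V p ∂(μ.prod μ) ≠ ⊤ := by
  intro hp
  lift ∫⁻ p, negPair V p ∂(μ.prod μ) to NNReal using hn with b hb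
  rw [IVE2_eq, ← hb, hp] at h
  simp at h

lemma lintegral_posPair (hne : ∀ᵐ p ∂(μ.prod μ), p.1 ≠ p.2) :
    ∫⁻ p, posPair V p ∂(μ.prod μ) = ∫⁻ p, ENNReal.ofReal (pairEnergy V p) ∂(μ.prod μ) :=
  lintegral_congr_ae (hne.mono fun p hp => by simp [posPair, hp])

lemma lintegral_negPair (hne : ∀ᵐ p ∂(μ.prod μ), p.1 ≠ p.2) :
    ∫⁻ p, negPair V p ∂(μ.prod μ) = ∫⁻ p, ENNReal.ofReal (-pairEnergy V p) ∂(μ.prod μ) :=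
  lintegral_congr_ae (hne.mono fun p hp => by simp [negPair, hp])

lemma IVE2_eq_integral (hne : ∀ᵐ p ∂(μ.prod μ), p.1 ≠ p.2)
    (hint : Integrable (pairEnergy V) (μ.prod μ)) :
    IVE2 V μ = ((∫ p, pairEnergy V p ∂(μ.prod μ) : ℝ) : EReal) := by
  have hp : ∫⁻ p, ENNReal.ofReal (pairEnergy V p) ∂(μ.prod μ) ≠ ⊤ :=
    hint.lintegral_lt_top.ne
  have hn : ∫⁻ p, ENNReal.ofReal (-pairEnergy V p) ∂(μ.prod μ) ≠ ⊤ :=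
    hint.neg.lintegral_lt_top.ne
  rw [IVE2_eq, lintegral_posPair hne, lintegral_negPair hne,
    integral_eq_lintegral_pos_part_sub_lintegral_neg_part hint, EReal.coe_sub,
    EReal.coe_ennreal_toReal hp, EReal.coe_ennreal_toReal hn]

lemma integrable_pairEnergy (hV : Measurable V) (hne : ∀ᵐ p ∂(μ.prod μ), p.1 ≠ p.2)
    (hn : ∫⁻ p, negPair V p ∂(μ.prod μ) ≠ ⊤) (h : IVE2 V μ ≠ ⊤) :
    Integrable (pairEnergy V) (μ.prod μ) := by
  have hp := posPair_ne_top_of_IVE2 hn h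
  rw [lintegral_posPair hne] at hp
  rw [lintegral_negPair hne] at hn
  refine ⟨(measurable_pairEnergy hV).aestronglyMeasurable, ?_⟩
  have : ∀ r : ℝ, ‖r‖ₑ = ENNReal.ofReal r + ENNReal.ofReal (-r) := by
    intro r
    rw [Real.enorm_eq_ofReal_abs]
    rcases le_total 0 r with hr | hr
    · rw [abs_of_nonneg hr, ENNReal.ofReal_of_nonpos (neg_nonpos.2 hr), add_zero]
    · rw [abs_of_nonpos hr, ENNReal.ofReal_of_nonpos hr, zero_add]
  rw [hasFiniteIntegral_iff_enorm]
  simp only [this]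
  rw [lintegral_add_left (measurable_pairEnergy hV).ennreal_ofReal]
  exact ENNReal.add_lt_top.2 ⟨hp.lt_top, hn.lt_top⟩

lemma mul_lintegral_negPair_le {η κ ν : Measure Plane} [SFinite η] [SFinite κ] [SFinite ν]
    {a : ℝ≥0∞} (hη : a • η ≤ ν) (hκ : a • κ ≤ ν) :
    a * (a * ∫⁻ p, negPair V p ∂(η.prod κ)) ≤ ∫⁻ p, negPair V p ∂(ν.prod ν) := by
  refine le_trans (le_of_eq ?_) (lintegral_mono' (Measure.prod_mono hη hκ) le_rfl)
  rw [Measure.prod_smul_left, Measure.prod_smul_right, lintegral_smul_measure,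
    lintegral_smul_measure, smul_eq_mul, smul_eq_mul]

/-- The average of two probability measures. -/
lemma isProbabilityMeasure_half_add (η κ : Measure Plane) [IsProbabilityMeasure η]
    [IsProbabilityMeasure κ] : IsProbabilityMeasure ((2⁻¹ : ℝ≥0∞) • η + (2⁻¹ : ℝ≥0∞) • κ) :=
  ⟨by simp [ENNReal.inv_two_add_inv_two]⟩

/-- The negative part of the energy of a unique minimiser without atoms is finite. -/
lemma negPair_ne_top_of_unique [IsProbabilityMeasure μ] (hμ0 : μ {0} = 0)
    (huniq : ∀ ν : Measure Plane, IsProbabilityMeasure ν → IVE2 V ν = IVE2 V μ → ν = μ) :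
    ∫⁻ p, negPair V p ∂(μ.prod μ) ≠ ⊤ := by
  intro htop
  have hprob := isProbabilityMeasure_half_add μ (Measure.dirac 0)
  set ν : Measure Plane := (2⁻¹ : ℝ≥0∞) • μ + (2⁻¹ : ℝ≥0∞) • Measure.dirac 0 with hν
  have hle : (2⁻¹ : ℝ≥0∞) • μ ≤ ν := Measure.le_add_right le_rfl
  have h := mul_lintegral_negPair_le (V := V) hle hle
  rw [htop, ENNReal.mul_top (by simp), ENNReal.mul_top (by simp), top_le_iff] at h
  have heq := huniq ν hprob (by rw [IVE2_eq_bot_of_negPair h, IVE2_eq_bot_of_negPair htop])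
  have : ν {0} = 0 := by rw [heq, hμ0]
  simp [hν] at this

/-- A function that is integrable against every probability measure is bounded. -/
lemma exists_le_of_lintegral_ne_top {h : Plane → ℝ≥0∞}
    (hint : ∀ ν : Measure Plane, IsProbabilityMeasure ν → ∫⁻ x, h x ∂ν ≠ ⊤) :
    ∃ B : ℕ, ∀ x, h x ≤ B := by
  by_contra! hcon
  choose x hx using fun k : ℕ => hcon (2 ^ (k + 1))
  set ν : Measure Plane := Measure.sum fun k : ℕ => ((2⁻¹ : ℝ≥0∞) ^ (k + 1)) • Measure.dirac (x k)
  have hν : IsProbabilityMeasure ν := by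
    refine ⟨?_⟩
    rw [Measure.sum_apply _ MeasurableSet.univ]
    simp [ENNReal.tsum_geometric_add_one, ENNReal.one_sub_inv_two, ENNReal.inv_mul_cancel]
  refine hint ν hν ?_
  rw [lintegral_sum_measure, ← top_le_iff, ← ENNReal.tsum_const_eq_top_of_ne_zero
    (α := ℕ) (one_ne_zero)]
  refine ENNReal.tsum_le_tsum fun k => ?_
  rw [lintegral_smul_measure, lintegral_dirac, smul_eq_mul, ← ENNReal.inv_pow]
  calc (1 : ℝ≥0∞) = (2 ^ (k + 1))⁻¹ * 2 ^ (k + 1) := by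
        rw [ENNReal.inv_mul_cancel (by simp) (by simp)]
    _ ≤ _ := by
        gcongr
        exact_mod_cast (hx k).le

/-- Finiteness of the energy from below forces `V / 2 - log(1 + |x|)` to be bounded below. -/
lemma exists_le_compWeight (hV : Continuous V)
    (h : ∀ ν : Measure Plane, IsProbabilityMeasure ν → ∫⁻ p, negPair V p ∂(ν.prod ν) ≠ ⊤) :
    ∃ B : ℝ, ∀ x, B ≤ compWeight V x := by
  obtain ⟨b, hb⟩ := exists_le_of_lintegral_ne_top (h := fun x => negPair V (0, x)) (by
    intro η hη htop
    have hprob := isProbabilityMeasure_half_add (Measure.dirac 0) η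
    refine h _ hprob ?_
    have hle := mul_lintegral_negPair_le (V := V)
      (ν := (2⁻¹ : ℝ≥0∞) • Measure.dirac 0 + (2⁻¹ : ℝ≥0∞) • η)
      (Measure.le_add_right le_rfl) (Measure.le_add_left le_rfl)
    rw [lintegral_prod _ (measurable_negPair hV.measurable).aemeasurable, lintegral_dirac, htop,
      ENNReal.mul_top (by simp), ENNReal.mul_top (by simp), top_le_iff] at hle
    exact hle)
  obtain ⟨c, hc⟩ := (isCompact_closedBall (0 : Plane) 1).bddBelow_image
    (continuous_compWeight hV).continuousOn
  refine ⟨min c (-b - compWeight V 0 - Real.log 2), fun x => ?_⟩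
  rcases le_total ‖x‖ 1 with hx | hx
  · exact (min_le_left _ _).trans (hc ⟨x, by simpa using hx, rfl⟩)
  · refine (min_le_right _ _).trans ?_
    have hx0 : (0 : Plane) ≠ x := by
      rintro rfl
      norm_num at hx
    have h1 := hb x
    simp only [negPair, hx0, if_false] at h1
    rw [← ENNReal.ofReal_natCast, ENNReal.ofReal_le_ofReal_iff (by positivity),
      pairEnergy_eq] at h1
    have h2 := compKernel_le 0 x
    have h3 : logPole (0 - x) = 0 := by
      simp [logPole, Real.log_nonneg hx]
    rw [h3, norm_zero, add_zero, Real.log_one] at h2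
    linarith

end MeanFieldEnergy

section Variation

variable {V : Plane → ℝ} {μ κ : Measure Plane} {M K : ℝ≥0∞} {R : ℝ}

lemma smul_measure_mono (a : ℝ≥0∞) (h : μ ≤ κ) : a • μ ≤ a • κ := fun s => by
  simp only [Measure.smul_apply, smul_eq_mul]
  exact mul_le_mul_right (h s) a

lemma integrable_of_continuous [IsFiniteMeasure κ] {φ : Plane → ℝ} (hφ : Continuous φ)
    (hR : κ (Metric.closedBall 0 R)ᶜ = 0) : Integrable φ κ := by
  obtain ⟨C, hC⟩ := (isCompact_closedBall (0 : Plane) R).exists_bound_of_continuousOn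
    hφ.continuousOn
  refine Integrable.of_bound hφ.aestronglyMeasurable C ?_
  filter_upwards [mem_ae_iff.2 hR] with x hx using hC x hx

lemma continuous_log_one_add_norm : Continuous fun x : Plane => Real.log (1 + ‖x‖) := by
  have h : ∀ x : Plane, 1 + ‖x‖ ≠ 0 := fun x => by positivity
  fun_prop (disch := exact h _)

lemma integrable_pairEnergy_of_bounded [IsFiniteMeasure κ] (hV : Continuous V) (hK : K ≠ ⊤)
    (hκ : κ ≤ K • volume) (hR : κ (Metric.closedBall 0 R)ᶜ = 0) :
    Integrable (pairEnergy V) (κ.prod κ) := by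
  have hVκ : Integrable (fun x => V x / 2) κ := (integrable_of_continuous hV hR).div_const 2
  exact (integrable_prod_gR2 hK hκ (integrable_of_continuous continuous_log_one_add_norm hR)).add
    ((hVκ.comp_fst κ).add (hVκ.comp_snd κ))

/-- Integrability of the two-point energy yields integrability of the one-point weight. -/
lemma integrable_compWeight [IsProbabilityMeasure μ] (hM : M ≠ ⊤)
    (hμ : μ ≤ M • volume) (hint : Integrable (pairEnergy V) (μ.prod μ)) :
    Integrable (compWeight V) μ := by
  obtain ⟨x, hx⟩ := hint.prod_right_ae.exists
  have h := (hx.sub (integrable_compKernel hM hμ x)).sub (integrable_const (compWeight V x))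
  refine h.congr (Eventually.of_forall fun y => ?_)
  simp only [Pi.sub_apply, pairEnergy_eq]
  ring

lemma integrable_pairEnergy_prod [IsProbabilityMeasure μ] [IsFiniteMeasure κ] (hV : Continuous V)
    (hM : M ≠ ⊤) (hμ : μ ≤ M • volume) (hint : Integrable (pairEnergy V) (μ.prod μ))
    (hR : κ (Metric.closedBall 0 R)ᶜ = 0) : Integrable (pairEnergy V) (κ.prod μ) := by
  have hw := integrable_compWeight hM hμ hint
  have hwκ : Integrable (compWeight V) κ := integrable_of_continuous (continuous_compWeight hV) hR
  have hlκ := integrable_of_continuous continuous_log_one_add_norm hR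
  have hdom : Integrable (fun p : Plane × Plane =>
      2 * Real.log (1 + ‖p.1‖) + (logPole (p.1 - p.2) + Real.log 2)) (κ.prod μ) :=
    ((hlκ.const_mul 2).comp_fst μ).add
      ((integrable_prod_logPole hM κ hμ).add (integrable_const _))
  have hker : Integrable (fun p : Plane × Plane => compKernel p.1 p.2) (κ.prod μ) :=
    hdom.mono' measurable_compKernel.aestronglyMeasurable (Eventually.of_forall fun p => by
      rw [Real.norm_of_nonneg (compKernel_nonneg _ _)]
      exact compKernel_le _ _)
  refine (((hwκ.comp_fst μ).add (hw.comp_snd κ)).add hker).congr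
    (Eventually.of_forall ?_)
  rintro ⟨x, y⟩
  simp only [Pi.add_apply, pairEnergy_eq]

lemma nonneg_of_forall_quadratic {a b c : ℝ}
    (h : ∀ t ∈ Set.Ioo (0 : ℝ) 1, a ≤ (1 - t) ^ 2 * a + 2 * t * (1 - t) * b + t ^ 2 * c) :
    a ≤ b := by
  by_contra! hab
  have hd : 0 < |a - 2 * b + c| + 2 * (a - b) := by positivity
  set t : ℝ := (a - b) / (|a - 2 * b + c| + 2 * (a - b)) with ht
  have ht0 : 0 < t := div_pos (by linarith) hd
  have ht1 : t < 1 := by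
    rw [ht, div_lt_one hd]
    linarith [abs_nonneg (a - 2 * b + c)]
  have h1 := h t ⟨ht0, ht1⟩
  have h2 : t * (|a - 2 * b + c| + 2 * (a - b)) = a - b := div_mul_cancel₀ _ hd.ne'
  have h3 : 2 * (a - b) ≤ t * (a - 2 * b + c) := by
    have : t * (2 * (a - b)) ≤ t * (t * (a - 2 * b + c)) := by linarith
    exact le_of_mul_le_mul_left this ht0
  nlinarith [le_abs_self (a - 2 * b + c)]

/-- First variation of the energy in the direction of a bounded, compactly supported density. -/
lemma integral_pairEnergy_le_of_min [IsProbabilityMeasure μ] [IsProbabilityMeasure κ]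
    (hV : Continuous V) (hM : M ≠ ⊤) (hμ : μ ≤ M • volume)
    (hint : Integrable (pairEnergy V) (μ.prod μ))
    (hmin : ∀ ν : Measure Plane, IsProbabilityMeasure ν → IVE2 V μ ≤ IVE2 V ν)
    (hK : K ≠ ⊤) (hκ : κ ≤ K • volume) (hR : κ (Metric.closedBall 0 R)ᶜ = 0) :
    ∫ p, pairEnergy V p ∂(μ.prod μ) ≤ ∫ p, pairEnergy V p ∂(κ.prod μ) := by
  have hκκ := integrable_pairEnergy_of_bounded hV hK hκ hR
  have hκμ := integrable_pairEnergy_prod hV hM hμ hint hR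
  have hswap : (fun p => pairEnergy V (Prod.swap p)) = pairEnergy V :=
    funext (pairEnergy_swap V)
  have hμκ : Integrable (pairEnergy V) (μ.prod κ) := by
    have := hκμ.swap
    rwa [show pairEnergy V ∘ Prod.swap = pairEnergy V from hswap] at this
  have hμκ' : ∫ p, pairEnergy V p ∂(μ.prod κ) = ∫ p, pairEnergy V p ∂(κ.prod μ) := by
    rw [← integral_prod_swap, hswap]
  refine nonneg_of_forall_quadratic (c := ∫ p, pairEnergy V p ∂(κ.prod κ)) fun t ht => ?_
  obtain ⟨ht0, ht1⟩ := ht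
  set ν : Measure Plane := ENNReal.ofReal (1 - t) • μ + ENNReal.ofReal t • κ with hν
  have hprob : IsProbabilityMeasure ν := by
    refine ⟨?_⟩
    simp only [hν, Measure.add_apply, Measure.smul_apply, measure_univ, smul_eq_mul, mul_one]
    rw [← ENNReal.ofReal_add (by linarith) ht0.le]
    simp
  have hνle : ν ≤ (ENNReal.ofReal (1 - t) * M + ENNReal.ofReal t * K) • volume := by
    rw [add_smul, mul_smul, mul_smul]
    exact add_le_add (smul_measure_mono _ hμ) (smul_measure_mono _ hκ)
  have hexp : ν.prod ν
      = ENNReal.ofReal (1 - t) • ENNReal.ofReal (1 - t) • μ.prod μ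
        + ENNReal.ofReal (1 - t) • ENNReal.ofReal t • κ.prod μ
        + (ENNReal.ofReal t • ENNReal.ofReal (1 - t) • μ.prod κ
        + ENNReal.ofReal t • ENNReal.ofReal t • κ.prod κ) := by
    rw [hν, Measure.prod_add, Measure.add_prod, Measure.add_prod]
    simp only [Measure.prod_smul_left, Measure.prod_smul_right]
  have hsm : ∀ {η : Measure (Plane × Plane)} (a b : ℝ), Integrable (pairEnergy V) η →
      Integrable (pairEnergy V) (ENNReal.ofReal a • ENNReal.ofReal b • η) := fun a b h =>
    (h.smul_measure ENNReal.ofReal_ne_top).smul_measure ENNReal.ofReal_ne_top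
  have h1 := hsm (1 - t) (1 - t) hint
  have h2 := hsm (1 - t) t hκμ
  have h3 := hsm t (1 - t) hμκ
  have h4 := hsm t t hκκ
  have hνint : Integrable (pairEnergy V) (ν.prod ν) := by
    rw [hexp]
    exact (h1.add_measure h2).add_measure (h3.add_measure h4)
  have h := hmin ν hprob
  rw [IVE2_eq_integral (ae_prod_ne μ hμ) hint, IVE2_eq_integral (ae_prod_ne ν hνle) hνint,
    EReal.coe_le_coe_iff, hexp, integral_add_measure (h1.add_measure h2) (h3.add_measure h4),
    integral_add_measure h1 h2, integral_add_measure h3 h4] at h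
  simp only [integral_smul_measure, smul_eq_mul, ENNReal.toReal_ofReal ht0.le,
    ENNReal.toReal_ofReal (sub_nonneg.2 ht1.le), hμκ'] at h
  linarith

lemma exists_closedBall_inter_pos {S : Set Plane} (hS : volume S ≠ 0) :
    ∃ n : ℕ, volume (S ∩ Metric.closedBall 0 n) ≠ 0 := by
  by_contra! h
  refine hS (measure_mono_null ?_ (measure_iUnion_null h))
  intro x hx
  obtain ⟨n, hn⟩ := exists_nat_ge ‖x‖
  exact Set.mem_iUnion.2 ⟨n, hx, by simpa using hn⟩

/-- The Euler--Lagrange inequality for a minimiser. -/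
lemma ae_le_integral_pairEnergy [IsProbabilityMeasure μ]
    (hV : Continuous V) (hM : M ≠ ⊤) (hμ : μ ≤ M • volume)
    (hint : Integrable (pairEnergy V) (μ.prod μ))
    (hmin : ∀ ν : Measure Plane, IsProbabilityMeasure ν → IVE2 V μ ≤ IVE2 V ν) :
    ∀ᵐ x ∂(volume : Measure Plane),
      ∫ p, pairEnergy V p ∂(μ.prod μ) ≤ ∫ y, pairEnergy V (x, y) ∂μ := by
  set E : ℝ := ∫ p, pairEnergy V p ∂(μ.prod μ) with hE
  set u : Plane → ℝ := fun x => ∫ y, pairEnergy V (x, y) ∂μ with hu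
  have hum : Measurable u :=
    ((measurable_pairEnergy hV.measurable).stronglyMeasurable.integral_prod_right').measurable
  by_contra hcon
  have hpos : volume {x | u x < E} ≠ 0 := by
    intro h0
    refine hcon ?_
    rw [ae_iff]
    simpa [not_le] using h0
  obtain ⟨n, hn⟩ := exists_closedBall_inter_pos hpos
  set A : Set Plane := {x | u x < E} ∩ Metric.closedBall 0 n with hA
  have hAm : MeasurableSet A :=
    (measurableSet_lt hum measurable_const).inter Metric.isClosed_closedBall.measurableSet
  have hAfin : volume A ≠ ⊤ :=
    ((measure_mono Set.inter_subset_right).trans_lt measure_closedBall_lt_top).ne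
  set κ : Measure Plane := (volume A)⁻¹ • volume.restrict A with hκ
  have hprob : IsProbabilityMeasure κ := ⟨by simp [hκ, ENNReal.inv_mul_cancel hn hAfin]⟩
  have hκle : κ ≤ (volume A)⁻¹ • volume := smul_measure_mono _ Measure.restrict_le_self
  have hκA : ∀ᵐ x ∂κ, x ∈ A := Measure.ae_smul_measure (ae_restrict_mem hAm) _
  have hR : κ (Metric.closedBall 0 n)ᶜ = 0 :=
    mem_ae_iff.1 (hκA.mono fun x hx => hx.2)
  have h := integral_pairEnergy_le_of_min hV hM hμ hint hmin (ENNReal.inv_ne_top.2 hn) hκle hR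
  have hκμ := integrable_pairEnergy_prod hV hM hμ hint hR
  rw [integral_prod _ hκμ] at h
  have hui : Integrable u κ := hκμ.integral_prod_left
  have hlt : 0 < ∫ x, (E - u x) ∂κ := by
    rw [integral_pos_iff_support_of_nonneg_ae (hκA.mono fun x hx => sub_nonneg.2 hx.1.le)
      ((integrable_const E).sub hui)]
    have : κ Set.univ ≤ κ (Function.support fun x => E - u x) :=
      measure_mono_ae (hκA.mono fun x hx _ => (sub_pos.2 hx.1).ne')
    rw [measure_univ] at this
    exact one_pos.trans_le this
  rw [integral_sub (integrable_const E) hui] at hlt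
  simp only [integral_const, probReal_univ, one_smul] at hlt
  linarith

end Variation

section LogarithmicMoment

variable {V : Plane → ℝ} {μ : Measure Plane} {M : ℝ≥0∞}

lemma integrable_log_one_add_norm_of_le [IsProbabilityMeasure μ] (hM : M ≠ ⊤)
    (hμ : μ ≤ M • volume) {C : ℝ} (hC : ∀ᵐ x ∂μ, ∫ y, compKernel x y ∂μ ≤ C) :
    Integrable (fun y : Plane => Real.log (1 + ‖y‖)) μ := by
  by_cases hsupp : ∃ R : ℝ, μ (Metric.closedBall 0 R)ᶜ = 0
  · obtain ⟨R, hR⟩ := hsupp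
    exact integrable_of_continuous continuous_log_one_add_norm hR
  push Not at hsupp
  have hball : ∀ n : ℕ, Integrable (fun y : Plane => Real.log (1 + ‖y‖))
      (μ.restrict (Metric.closedBall 0 n)) := fun n =>
    integrable_of_continuous (R := n) continuous_log_one_add_norm (by
      rw [Measure.restrict_apply Metric.isClosed_closedBall.measurableSet.compl]
      simp)
  refine (aecover_closedBall (μ := μ) (x := 0)
    (tendsto_natCast_atTop_atTop (R := ℝ))).integrable_of_integral_bounded_of_nonneg_ae
    (C + Real.log 2) hball (Eventually.of_forall log_one_add_norm_nonneg)
    (Eventually.of_forall fun n => ?_)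
  obtain ⟨x, hx, hxC⟩ := ((frequently_ae_mem_iff.2 (hsupp n)).and_eventually hC).exists
  have hxn : (n : ℝ) < ‖x‖ := by simpa using hx
  have hk : Integrable (fun y => compKernel x y + Real.log 2) μ :=
    (integrable_compKernel hM hμ x).add (integrable_const _)
  calc ∫ y in Metric.closedBall 0 n, Real.log (1 + ‖y‖) ∂μ
      ≤ ∫ y in Metric.closedBall 0 n, (compKernel x y + Real.log 2) ∂μ := by
        refine setIntegral_mono_on (hball n) hk.integrableOn
          Metric.isClosed_closedBall.measurableSet fun y hy => ?_
        have hy' : ‖y‖ ≤ n := by simpa using hy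
        linarith [log_sub_log_two_le_compKernel (hy'.trans hxn.le)]
    _ ≤ ∫ y, (compKernel x y + Real.log 2) ∂μ :=
        setIntegral_le_integral hk (Eventually.of_forall fun y =>
          add_nonneg (compKernel_nonneg x y) (Real.log_nonneg one_le_two))
    _ = ∫ y, compKernel x y ∂μ + Real.log 2 := by
        rw [integral_add (integrable_compKernel hM hμ x) (integrable_const _)]
        simp
    _ ≤ C + Real.log 2 := by linarith

lemma integral_pairEnergy_eq_compKernel [IsProbabilityMeasure μ] (hM : M ≠ ⊤)
    (hμ : μ ≤ M • volume) (hw : Integrable (compWeight V) μ) (x : Plane) :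
    ∫ y, pairEnergy V (x, y) ∂μ
      = compWeight V x + ∫ y, compWeight V y ∂μ + ∫ y, compKernel x y ∂μ := by
  have hs : Integrable (fun y => compWeight V x + compWeight V y) μ :=
    (integrable_const _).add hw
  simp only [pairEnergy_eq]
  rw [integral_add hs (integrable_compKernel hM hμ x), integral_add (integrable_const _) hw]
  simp

/-- The Euler--Lagrange inequality becomes an equality on the support of the minimiser. -/
lemma ae_integral_pairEnergy_eq [IsProbabilityMeasure μ] (hμ : μ ≤ M • volume)
    (hint : Integrable (pairEnergy V) (μ.prod μ))
    (hEL : ∀ᵐ x ∂(volume : Measure Plane),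
      ∫ p, pairEnergy V p ∂(μ.prod μ) ≤ ∫ y, pairEnergy V (x, y) ∂μ) :
    ∀ᵐ x ∂μ, ∫ y, pairEnergy V (x, y) ∂μ = ∫ p, pairEnergy V p ∂(μ.prod μ) := by
  have hELμ : ∀ᵐ x ∂μ, ∫ p, pairEnergy V p ∂(μ.prod μ) ≤ ∫ y, pairEnergy V (x, y) ∂μ :=
    ae_mono hμ (Measure.ae_smul_measure hEL M)
  have hu := hint.integral_prod_left
  have h0 : ∫ x, (∫ y, pairEnergy V (x, y) ∂μ - ∫ p, pairEnergy V p ∂(μ.prod μ)) ∂μ = 0 := by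
    rw [integral_sub hu (integrable_const _), integral_prod _ hint]
    simp
  have h := (integral_eq_zero_iff_of_nonneg_ae (hELμ.mono fun x hx => sub_nonneg.2 hx)
    (hu.sub (integrable_const _))).1 h0
  exact h.mono fun x hx => sub_eq_zero.1 hx

/-- Regularity of the equilibrium measure and its Euler--Lagrange inequality. -/
theorem equilibrium_regularity [IsProbabilityMeasure μ] (hV : Continuous V)
    (hM : M ≠ ⊤) (hμ : μ ≤ M • volume)
    (hmin : ∀ ν : Measure Plane, IsProbabilityMeasure ν → IVE2 V μ ≤ IVE2 V ν)
    (huniq : ∀ ν : Measure Plane, IsProbabilityMeasure ν → IVE2 V ν = IVE2 V μ → ν = μ) :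
    Integrable (fun y : Plane => Real.log (1 + ‖y‖)) μ ∧ Integrable V μ ∧
      ∀ᵐ x ∂(volume : Measure Plane),
        IVr2 V μ ≤ hpot2 μ x + V x / 2 + (∫ y, V y ∂μ) / 2 := by
  have hμ0 : μ {0} = 0 := by
    have := ae_ne_of_le_smul_volume hμ 0
    rw [ae_iff] at this
    simpa [eq_comm] using this
  have hnμ := negPair_ne_top_of_unique hμ0 huniq
  have hn : ∀ ν : Measure Plane, IsProbabilityMeasure ν →
      ∫⁻ p, negPair V p ∂(ν.prod ν) ≠ ⊤ := fun ν hν htop =>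
    IVE2_ne_bot_of_negPair hnμ (le_bot_iff.1 ((hmin ν hν).trans_eq (IVE2_eq_bot_of_negPair htop)))
  obtain ⟨B, hB⟩ := exists_le_compWeight hV hn
  have hfin : IVE2 V μ ≠ ⊤ := by
    set A : Set Plane := Metric.closedBall 0 1 with hA
    have hA0 : volume A ≠ 0 := (Metric.measure_closedBall_pos volume 0 one_pos).ne'
    have hAfin : volume A ≠ ⊤ := measure_closedBall_lt_top.ne
    set κ : Measure Plane := (volume A)⁻¹ • volume.restrict A with hκ
    have hprob : IsProbabilityMeasure κ := ⟨by simp [hκ, ENNReal.inv_mul_cancel hA0 hAfin]⟩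
    have hκle : κ ≤ (volume A)⁻¹ • volume := smul_measure_mono _ Measure.restrict_le_self
    have hR : κ Aᶜ = 0 := by
      rw [hκ, Measure.smul_apply,
        Measure.restrict_apply Metric.isClosed_closedBall.measurableSet.compl, ← hA]
      simp
    have hint := integrable_pairEnergy_of_bounded hV (ENNReal.inv_ne_top.2 hA0) hκle hR
    have h := hmin κ hprob
    rw [IVE2_eq_integral (ae_prod_ne κ hκle) hint] at h
    exact (h.trans_lt (EReal.coe_lt_top _)).ne
  have hint := integrable_pairEnergy hV.measurable (ae_prod_ne μ hμ) hnμ hfin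
  have hw := integrable_compWeight hM hμ hint
  have hEL := ae_le_integral_pairEnergy hV hM hμ hint hmin
  have hlog : Integrable (fun y : Plane => Real.log (1 + ‖y‖)) μ := by
    refine integrable_log_one_add_norm_of_le hM hμ
      (C := ∫ p, pairEnergy V p ∂(μ.prod μ) - B - ∫ y, compWeight V y ∂μ) ?_
    filter_upwards [ae_integral_pairEnergy_eq hμ hint hEL] with x hx
    rw [integral_pairEnergy_eq_compKernel hM hμ hw] at hx
    linarith [hB x]
  have hV2 : Integrable (fun x => V x / 2) μ := by
    refine (hw.add hlog).congr (Eventually.of_forall fun x => ?_)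
    simp [compWeight]
  have hVint : Integrable V μ := by
    refine (hV2.const_mul 2).congr (Eventually.of_forall fun x => ?_)
    ring
  refine ⟨hlog, hVint, ?_⟩
  have hg := integrable_prod_gR2 hM hμ hlog
  have hE : ∫ p, pairEnergy V p ∂(μ.prod μ) = IVr2 V μ := by
    have h1 : Integrable (fun p : Plane × Plane => V p.1 / 2) (μ.prod μ) := hV2.comp_fst μ
    have h2 : Integrable (fun p : Plane × Plane => V p.2 / 2) (μ.prod μ) := hV2.comp_snd μ
    have e1 : ∫ p : Plane × Plane, V p.1 / 2 ∂(μ.prod μ) = (∫ y, V y ∂μ) / 2 := by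
      rw [integral_fun_fst (fun x => V x / 2), integral_div]
      simp
    have e2 : ∫ p : Plane × Plane, V p.2 / 2 ∂(μ.prod μ) = (∫ y, V y ∂μ) / 2 := by
      rw [integral_fun_snd (fun x => V x / 2), integral_div]
      simp
    have h12 : Integrable (fun p : Plane × Plane => V p.1 / 2 + V p.2 / 2) (μ.prod μ) := h1.add h2
    unfold pairEnergy IVr2
    rw [integral_add hg h12, integral_add h1 h2, e1, e2]
    ring
  filter_upwards [hEL] with x hx
  rw [hE] at hx
  refine hx.trans_eq ?_
  have hVx : Integrable (fun y => V x / 2 + V y / 2) μ := (integrable_const _).add hV2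
  simp only [pairEnergy]
  rw [integral_add (integrable_gR2_sub hM hμ hlog x) hVx, integral_add (integrable_const _) hV2,
    integral_div (2 : ℝ) V]
  simp [hpot2, add_assoc]

end LogarithmicMoment

section GibbsMeasure

variable {V : Plane → ℝ} {μ : Measure Plane} {M : ℝ≥0∞}

lemma volume_setOf_apply_eq_apply {N : ℕ} {i j : Fin N} (hij : i ≠ j) :
    volume {X : Fin N → Plane | X i = X j} = 0 := by
  let L : (Fin N → Plane) →ₗ[ℝ] Plane := (LinearMap.proj i : (Fin N → Plane) →ₗ[ℝ] Plane) - LinearMap.proj j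
  have hL : {X : Fin N → Plane | X i = X j} = (LinearMap.ker L : Set (Fin N → Plane)) := by
    ext X
    simp [L, sub_eq_zero]
  rw [hL]
  refine Measure.addHaar_submodule volume _ fun htop => ?_
  obtain ⟨v, hv⟩ := exists_ne (0 : Plane)
  have : Pi.single i v ∈ LinearMap.ker L := htop ▸ Submodule.mem_top
  simp [L, Pi.single_eq_of_ne hij.symm, hv] at this

lemma ae_injective (N : ℕ) : ∀ᵐ X : Fin N → Plane, Function.Injective X := by
  have h : ∀ i j : Fin N, ∀ᵐ X : Fin N → Plane, X i = X j → i = j := by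
    intro i j
    by_cases hij : i = j
    · exact Eventually.of_forall fun _ _ => hij
    · rw [ae_iff]
      simpa [hij] using volume_setOf_apply_eq_apply hij
  filter_upwards [ae_all_iff.2 fun i => ae_all_iff.2 (h i)] with X hX i j using hX i j

lemma ae_forall_apply {N : ℕ} {p : Plane → Prop} (hp : ∀ᵐ x ∂(volume : Measure Plane), p x) :
    ∀ᵐ X : Fin N → Plane, ∀ i, p (X i) :=
  ae_all_iff.2 fun i => (Measure.tendsto_eval_ae_ae (i := i)).eventually hp

lemma FN2_eq_nextOrderEnergy {N : ℕ} {X : Fin N → Plane} (hX : Function.Injective X) :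
    FN2 N μ X = (nextOrderEnergy N μ X : EReal) := by
  have h : ∀ i j, (if i ≠ j then gE2 (X i - X j) else 0)
      = (((if i ≠ j then gR2 (X i - X j) else 0 : ℝ)) : EReal) := by
    intro i j
    by_cases hij : i = j
    · simp [hij]
    · simp [hij, gE2, sub_eq_zero, hX.ne hij]
  have hsum : ∀ f : Fin N → ℝ, ∑ i, (f i : EReal) = ((∑ i, f i : ℝ) : EReal) := fun f =>
    (map_sum (⟨⟨((↑) : ℝ → EReal), EReal.coe_zero⟩, EReal.coe_add⟩ : ℝ →+ EReal) f _).symm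
  unfold FN2 nextOrderEnergy
  simp only [h, hsum, ← EReal.coe_add]

lemma expE_coe (x : ℝ) : expE x = ENNReal.ofReal (Real.exp x) := by
  simp [expE]

/-- The splitting inequality `F_N + N² I_V ≤ H_N`. -/
lemma nextOrderEnergy_le {N : ℕ} {X : Fin N → Plane}
    (hX : ∀ i, IVr2 V μ ≤ hpot2 μ (X i) + V (X i) / 2 + (∫ y, V y ∂μ) / 2) :
    nextOrderEnergy N μ X ≤ HN2 N V X - (N : ℝ) ^ 2 * IVr2 V μ := by
  have h := Finset.sum_le_sum fun i (_ : i ∈ Finset.univ) => hX i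
  simp only [Finset.sum_add_distrib, Finset.sum_const, Finset.card_univ, Fintype.card_fin,
    nsmul_eq_mul, ← Finset.sum_div] at h
  have h2 := mul_le_mul_of_nonneg_left h (by positivity : (0 : ℝ) ≤ 2 * N)
  have hI : IVr2 V μ
    = (∫ p : Plane × Plane, gR2 (p.1 - p.2) ∂(μ.prod μ)) + ∫ x, V x ∂μ := rfl
  unfold nextOrderEnergy HN2
  set G := ∫ p : Plane × Plane, gR2 (p.1 - p.2) ∂(μ.prod μ)
  have hG : (N : ℝ) ^ 2 * G = N ^ 2 * IVr2 V μ - N ^ 2 * ∫ x, V x ∂μ := by rw [hI]; ring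
  linarith

lemma measurable_HN2 (hV : Measurable V) (N : ℕ) : Measurable (HN2 N V) := by
  have hg : ∀ i j : Fin N, Measurable fun X : Fin N → Plane => gR2 (X i - X j) := fun i j =>
    measurable_gR2.comp ((measurable_pi_apply i).sub (measurable_pi_apply j))
  unfold HN2
  refine Measurable.add (Finset.measurable_sum _ fun i _ => Finset.measurable_sum _ fun j _ => ?_)
    (measurable_const.mul (Finset.measurable_sum _ fun i _ => hV.comp (measurable_pi_apply i)))
  split_ifs
  exacts [hg i j, measurable_const]

lemma gibbs2_absolutelyContinuous (N : ℕ) (β : ℝ) (V : Plane → ℝ) :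
    gibbs2 N β V ≪ volume :=
  (withDensity_absolutelyContinuous _ _).smul_left _

/-- A partition function obeying the next-order expansion is a positive real number. -/
lemma ZexpansionBound.eventually_eq {β C : ℝ} (h : ZexpansionBound β V μ C) :
    ∀ᶠ N : ℕ in atTop, ∃ l : ℝ, ZN2 N β V = ENNReal.ofReal (Real.exp l) ∧
      l + ((β / 2) * (N : ℝ) ^ 2 * IVr2 V μ - (β / 4) * N * Real.log N) ≤ C * N ∧
      -(C * N) ≤ l + ((β / 2) * (N : ℝ) ^ 2 * IVr2 V μ - (β / 4) * N * Real.log N) := by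
  filter_upwards [h] with N hN
  obtain ⟨h1, h2⟩ := hN
  have h0 : ZN2 N β V ≠ 0 := by
    intro h0
    rw [h0, ENNReal.log_zero, EReal.bot_add] at h2
    exact EReal.coe_ne_bot _ (le_bot_iff.1 h2)
  have htop : ZN2 N β V ≠ ⊤ := by
    intro htop
    rw [htop, ENNReal.log_top, EReal.top_add_coe] at h1
    exact EReal.coe_ne_top _ (top_le_iff.1 h1)
  have hpos := ENNReal.toReal_pos h0 htop
  rw [ENNReal.log_pos_real h0 htop] at h1 h2
  refine ⟨Real.log (ZN2 N β V).toReal, ?_, by exact_mod_cast h1, by exact_mod_cast h2⟩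
  rw [Real.exp_log hpos, ENNReal.ofReal_toReal htop]

lemma gibbs2_univ {N : ℕ} {β l : ℝ} (hZ : ZN2 N β V = ENNReal.ofReal (Real.exp l)) :
    gibbs2 N β V Set.univ = 1 := by
  rw [gibbs2, Measure.smul_apply, withDensity_apply _ MeasurableSet.univ, Measure.restrict_univ,
    smul_eq_mul]
  change (ZN2 N β V)⁻¹ * ZN2 N β V = 1
  rw [hZ]
  exact ENNReal.inv_mul_cancel (by simp [Real.exp_pos]) ENNReal.ofReal_ne_top

lemma le_expMoment {N : ℕ} {β l c : ℝ} (hβ : 0 < β)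
    (hZ : ZN2 N β V = ENNReal.ofReal (Real.exp l))
    (hF : ∀ᵐ X : Fin N → Plane, c ≤ nextOrderEnergy N μ X + N / 2 * Real.log N) :
    ENNReal.ofReal (Real.exp (β / 4 * c)) ≤ expMoment N β V μ := by
  have h : ∀ᵐ X ∂(gibbs2 N β V), ENNReal.ofReal (Real.exp (β / 4 * c))
      ≤ expE (((β / 4 : ℝ) : EReal) *
        (FN2 N μ X + (((N : ℝ) / 2 * Real.log N : ℝ) : EReal))) := by
    filter_upwards [(gibbs2_absolutelyContinuous N β V).ae_le hF,
      (gibbs2_absolutelyContinuous N β V).ae_le (ae_injective N)] with X hX hinj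
    rw [FN2_eq_nextOrderEnergy hinj, ← EReal.coe_add, ← EReal.coe_mul, expE_coe]
    gcongr
  calc ENNReal.ofReal (Real.exp (β / 4 * c))
      = ∫⁻ _, ENNReal.ofReal (Real.exp (β / 4 * c)) ∂(gibbs2 N β V) := by
        rw [lintegral_const, gibbs2_univ hZ, mul_one]
    _ ≤ expMoment N β V μ := lintegral_mono_ae h

lemma expMoment_le {N : ℕ} {β : ℝ} (hβ : 0 < β) (hV : Measurable V)
    (hEL : ∀ᵐ x ∂(volume : Measure Plane),
      IVr2 V μ ≤ hpot2 μ x + V x / 2 + (∫ y, V y ∂μ) / 2) :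
    expMoment N β V μ ≤ (ZN2 N β V)⁻¹ *
      (ENNReal.ofReal (Real.exp (β / 4 * (N / 2 * Real.log N - (N : ℝ) ^ 2 * IVr2 V μ)))
        * ZN2 N (β / 2) V) := by
  set c : ℝ := N / 2 * Real.log N - (N : ℝ) ^ 2 * IVr2 V μ with hc
  have hH := measurable_HN2 hV N
  have hd : ∀ b : ℝ, Measurable fun X => ENNReal.ofReal (Real.exp (b * HN2 N V X)) := fun b =>
    (Real.measurable_exp.comp (hH.const_mul b)).ennreal_ofReal
  have h : ∀ᵐ X ∂(gibbs2 N β V), expE (((β / 4 : ℝ) : EReal) *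
        (FN2 N μ X + (((N : ℝ) / 2 * Real.log N : ℝ) : EReal)))
      ≤ ENNReal.ofReal (Real.exp (β / 4 * HN2 N V X)) * ENNReal.ofReal (Real.exp (β / 4 * c)) := by
    filter_upwards [(gibbs2_absolutelyContinuous N β V).ae_le (ae_forall_apply hEL),
      (gibbs2_absolutelyContinuous N β V).ae_le (ae_injective N)] with X hX hinj
    rw [FN2_eq_nextOrderEnergy hinj, ← EReal.coe_add, ← EReal.coe_mul, expE_coe,
      ← ENNReal.ofReal_mul (Real.exp_pos _).le, ← Real.exp_add, ← mul_add]
    have := nextOrderEnergy_le hX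
    refine ENNReal.ofReal_le_ofReal (Real.exp_le_exp.2 ?_)
    refine mul_le_mul_of_nonneg_left ?_ (by positivity)
    linarith
  refine (lintegral_mono_ae h).trans_eq ?_
  rw [lintegral_mul_const _ (hd _), gibbs2, lintegral_smul_measure,
    lintegral_withDensity_eq_lintegral_mul _ (hd _) (hd _), smul_eq_mul, mul_assoc]
  congr 1
  rw [mul_comm]
  congr 1
  refine lintegral_congr fun X => ?_
  rw [Pi.mul_apply, ← ENNReal.ofReal_mul (Real.exp_pos _).le, ← Real.exp_add]
  congr 2
  ring

end GibbsMeasure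

/-- exponential moment bound on the next-order energy under the Gibbs
measure: `|log E_{P_{N,β}}[exp((β/4)(F_N^{μ_V} + (N/2) log N))]| ≤ C N` for `N` large. -/
theorem statement_14 (β : ℝ) (hβ : 0 < β) (V : Plane → ℝ) (hV : Continuous V)
    (μV : Measure Plane) (hprob : IsProbabilityMeasure μV)
    (hmin : ∀ ν : Measure Plane, IsProbabilityMeasure ν → IVE2 V μV ≤ IVE2 V ν)
    (huniq : ∀ ν : Measure Plane, IsProbabilityMeasure ν → IVE2 V ν = IVE2 V μV → ν = μV)
    (hdens : ∃ (ρ : Plane → ℝ≥0∞) (M : ℝ), μV = volume.withDensity ρ ∧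
      ∀ x, ρ x ≤ ENNReal.ofReal M)
    (hA3 : ∃ N₀ : ℕ, ∀ N ≥ N₀,
      (∫⁻ x : Plane, ENNReal.ofReal (Real.exp (-β * N * (V x / 2 - Real.log ‖x‖)))) ≠ ⊤)
    (hZβ : ∃ C₁ : ℝ, ZexpansionBound β V μV C₁)
    (hZβ2 : ∃ C₂ : ℝ, ZexpansionBound (β / 2) V μV C₂) :
    ∃ C : ℝ, ∀ᶠ N : ℕ in atTop,
      ENNReal.log (expMoment N β V μV) ≤ ((C * N : ℝ) : EReal) ∧
      ((-(C * N) : ℝ) : EReal) ≤ ENNReal.log (expMoment N β V μV) := by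
  obtain ⟨ρ, M₀, rfl, hρ⟩ := hdens
  set μ : Measure Plane := volume.withDensity fun x => (ρ x : ℝ≥0∞) with hμdef
  set M : ℝ≥0∞ := ENNReal.ofReal M₀
  have hM : M ≠ ⊤ := ENNReal.ofReal_ne_top
  have hμ : μ ≤ M • volume := by
    rw [← withDensity_const]
    exact withDensity_mono (Eventually.of_forall hρ)
  obtain ⟨hlog, -, hEL⟩ := equilibrium_regularity hV hM hμ hmin huniq
  obtain ⟨C₁, hC₁⟩ := hZβ
  obtain ⟨C₂, hC₂⟩ := hZβ2
  set C₃ : ℝ := 1 / 2 + 2 * M.toReal * ∫ z, regRemainder z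
  refine ⟨max (C₁ + C₂) (β / 4 * C₃), ?_⟩
  filter_upwards [hC₁.eventually_eq, hC₂.eventually_eq, eventually_gt_atTop 0] with N h₁ h₂ hN
  obtain ⟨l₁, hZ₁, -, hl₁⟩ := h₁
  obtain ⟨l₂, hZ₂, hl₂, -⟩ := h₂
  have hlogexp : ∀ x : ℝ, ENNReal.log (ENNReal.ofReal (Real.exp x)) = (x : EReal) := fun x => by
    rw [ENNReal.log_ofReal_of_pos (Real.exp_pos x), Real.log_exp]
  constructor
  · have h := expMoment_le (N := N) hβ hV.measurable hEL
    rw [hZ₁, hZ₂, ← ENNReal.ofReal_inv_of_pos (Real.exp_pos _), ← Real.exp_neg,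
      ← ENNReal.ofReal_mul (Real.exp_pos _).le, ← Real.exp_add,
      ← ENNReal.ofReal_mul (Real.exp_pos _).le, ← Real.exp_add] at h
    refine (ENNReal.log_monotone h).trans ?_
    rw [hlogexp, EReal.coe_le_coe_iff]
    refine le_trans ?_ (mul_le_mul_of_nonneg_right (le_max_left _ _) N.cast_nonneg)
    linarith
  · have h := le_expMoment (N := N) (μ := μ) (c := -C₃ * N) hβ hZ₁ (by
      filter_upwards [ae_injective N] with X hX using le_nextOrderEnergy hM hμ hlog hN hX)
    refine le_trans ?_ (ENNReal.log_monotone h)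
    rw [hlogexp, EReal.coe_le_coe_iff]
    have := mul_le_mul_of_nonneg_right (le_max_right (C₁ + C₂) (β / 4 * C₃))
      (N.cast_nonneg (α := ℝ))
    linarith
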